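/- arXiv:2602.03044 — 3 statements merged into one kernel-verified Lean document; each statement's English description precedes it below -/
import Mathlib

section
/- Let n ≥ 2, 1 ≤ p ≤ q < n, set β = n(1/p − 1/q) + 1 (so that 1 ≤ β < n/p and np/(n−βp) = nq/(n−q)). Let α ∈ (0,∞), let B = B_R ⊂ ℝ^n be an open ball of radius R > 0, let a ∈ 𝒵^α(B), and assume q/p ≤ 1 + α/n (which gives 1 + α/q − β ≥ 0). Then there exists c = c(n,p,q,α,[a]_α) > 0 such that for every x ∈ B and every f ∈ L¹(B): a(x)^{1/q} I_1(f)(x) ≤ c I_1(a^{1/q} f)(x) + c R^{1 + α/q − β} I_β(f)(x). -/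
open MeasureTheory Metric ENNReal

/-- Riesz potential restricted to a set `B`:
`I_γ(f)(x) = ∫_B |f(y)| / |x-y|^{n-γ} dy`, taking values in `ℝ≥0∞`. -/
noncomputable def rieszPot {n : ℕ} (B : Set (EuclideanSpace ℝ (Fin n))) (γ : ℝ)
    (f : EuclideanSpace ℝ (Fin n) → ℝ) (x : EuclideanSpace ℝ (Fin n)) : ℝ≥0∞ :=
  ∫⁻ y in B, ENNReal.ofReal (|f y| / ‖x - y‖ ^ ((n : ℝ) - γ))

/-- Splitting of the weight inside the kernel of the Riesz potential. -/
lemma weighted_kernel_le {q α C s A b d F R m k : ℝ} (hq : 1 ≤ q) (hC : 0 < C) (hs : 0 ≤ s)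
    (hm : 0 < m) (hexp : α / q - m = s - k) (hA : 0 ≤ A) (hb : 0 ≤ b) (hd : 0 ≤ d)
    (hdR : d ≤ 2 * R) (hR : 0 < R) (hF : 0 ≤ F) (h : A ≤ C * (b + d ^ α)) :
    A ^ (1 / q) * (F / d ^ m) ≤ C ^ (1 / q) * 2 ^ s * (b ^ (1 / q) * F / d ^ m)
      + C ^ (1 / q) * 2 ^ s * R ^ s * (F / d ^ k) := by
  have hq0 : 0 < q := by linarith
  rcases hd.eq_or_lt with rfl | hd0
  · rw [Real.zero_rpow hm.ne', _root_.div_zero, mul_zero]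
    positivity
  have hA' : A ^ (1 / q) ≤ C ^ (1 / q) * (b ^ (1 / q) + d ^ (α / q)) := calc
    A ^ (1 / q) ≤ (C * (b + d ^ α)) ^ (1 / q) := by gcongr
    _ = C ^ (1 / q) * (b + d ^ α) ^ (1 / q) := Real.mul_rpow hC.le (by positivity)
    _ ≤ C ^ (1 / q) * (b ^ (1 / q) + (d ^ α) ^ (1 / q)) := by
      gcongr
      exact Real.rpow_add_le_add_rpow hb (by positivity) (by positivity)
        ((div_le_one hq0).2 hq)
    _ = C ^ (1 / q) * (b ^ (1 / q) + d ^ (α / q)) := by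
      rw [← Real.rpow_mul hd, mul_one_div]
  have hkernel : d ^ (α / q) / d ^ m ≤ 2 ^ s * R ^ s / d ^ k := calc
    d ^ (α / q) / d ^ m = d ^ s / d ^ k := by
      rw [← Real.rpow_sub hd0, hexp, Real.rpow_sub hd0]
    _ ≤ (2 * R) ^ s / d ^ k := by gcongr
    _ = 2 ^ s * R ^ s / d ^ k := by rw [Real.mul_rpow zero_le_two hR.le]
  have h2 : (1 : ℝ) ≤ 2 ^ s := Real.one_le_rpow one_le_two hs
  calc A ^ (1 / q) * (F / d ^ m)
      ≤ C ^ (1 / q) * (b ^ (1 / q) + d ^ (α / q)) * (F / d ^ m) := by gcongr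
    _ = C ^ (1 / q) * 1 * (b ^ (1 / q) * F / d ^ m)
        + C ^ (1 / q) * F * (d ^ (α / q) / d ^ m) := by ring
    _ ≤ C ^ (1 / q) * 2 ^ s * (b ^ (1 / q) * F / d ^ m)
        + C ^ (1 / q) * F * (2 ^ s * R ^ s / d ^ k) := by gcongr
    _ = _ := by ring

/-- **Lemma 3.1 (iii)**: let `1 ≤ p ≤ q < n`, `β = n(1/p - 1/q) + 1`, `α > 0`,
`a ∈ 𝒵^α(B)` (with constant `Ca`) and `q/p ≤ 1 + α/n`.  Then there is
`c = c(n,p,q,α,[a]_α) > 0` with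
`a(x)^{1/q} I₁(f)(x) ≤ c I₁(a^{1/q} f)(x) + c R^{1+α/q-β} I_β(f)(x)`
for all `x ∈ B` and `f ∈ L¹(B)`. -/
theorem riesz_weighted_bound (n : ℕ) (hn : 2 ≤ n) (p q α Ca : ℝ)
    (hp : 1 ≤ p) (hpq : p ≤ q) (hqn : q < n) (hα : 0 < α) (hCa : 0 < Ca)
    (hgap : q / p ≤ 1 + α / n) :
    ∃ c : ℝ, 0 < c ∧
      ∀ (x₀ : EuclideanSpace ℝ (Fin n)) (R : ℝ), 0 < R →
      ∀ a : EuclideanSpace ℝ (Fin n) → ℝ, Measurable a →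
        (∀ x ∈ ball x₀ R, 0 ≤ a x) →
        (∀ x ∈ ball x₀ R, ∀ y ∈ ball x₀ R, a x ≤ Ca * (a y + dist x y ^ α)) →
      ∀ f : EuclideanSpace ℝ (Fin n) → ℝ, IntegrableOn f (ball x₀ R) →
      ∀ x ∈ ball x₀ R,
        ENNReal.ofReal (a x ^ (1 / q)) * rieszPot (ball x₀ R) 1 f x
          ≤ ENNReal.ofReal c * rieszPot (ball x₀ R) 1 (fun y => a y ^ (1 / q) * f y) x
            + ENNReal.ofReal (c * R ^ (1 + α / q - (n * (1 / p - 1 / q) + 1))) *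
              rieszPot (ball x₀ R) (n * (1 / p - 1 / q) + 1) f x := by
  have hp0 : 0 < p := by linarith
  have hq : 1 ≤ q := hp.trans hpq
  have hq0 : 0 < q := by linarith
  have hn0 : (0 : ℝ) < n := hq0.trans hqn
  have hs : 0 ≤ 1 + α / q - (n * (1 / p - 1 / q) + 1) := by
    have h := mul_le_mul_of_nonneg_right hgap (div_nonneg hn0.le hq0.le)
    have e₁ : q / p * (n / q) = n * (1 / p) := by field_simp
    have e₂ : (1 + α / n) * (n / q) = n * (1 / q) + α / q := by field_simp
    rw [e₁, e₂] at h
    linarith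
  set β : ℝ := n * (1 / p - 1 / q) + 1
  refine ⟨Ca ^ (1 / q) * 2 ^ (1 + α / q - β), by positivity, ?_⟩
  intro x₀ R hR a ham ha hZ f hf x hx
  unfold rieszPot
  rw [← lintegral_const_mul' _ _ ofReal_ne_top, ← lintegral_const_mul' _ _ ofReal_ne_top,
    ← lintegral_const_mul' _ _ ofReal_ne_top, ← lintegral_add_left']
  · refine setLIntegral_mono' measurableSet_ball fun y hy => ?_
    rw [← ENNReal.ofReal_mul (Real.rpow_nonneg (ha x hx) _),
      ← ENNReal.ofReal_mul (by positivity), ← ENNReal.ofReal_mul (by positivity),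
      ← ENNReal.ofReal_add (by positivity) (by positivity), abs_mul,
      abs_of_nonneg (Real.rpow_nonneg (ha y hy) _)]
    refine ENNReal.ofReal_le_ofReal (weighted_kernel_le (α := α) hq hCa hs (by linarith) (by ring)
      (ha x hx) (ha y hy) (norm_nonneg _) ?_ hR (abs_nonneg _) ?_)
    · rw [← dist_eq_norm]
      linarith [dist_triangle_right x y x₀, mem_ball.1 hx, mem_ball.1 hy]
    · rw [← dist_eq_norm]
      exact hZ x hx y hy
  · have hfm := hf.aestronglyMeasurable.aemeasurable
    fun_prop
end

section
/- Let n ≥ 2 and 0 < β < n. Then there exists c = c(n,β) > 0 such that M(M_β(f))(x) ≤ c M_β(f)(x) for every x ∈ ℝ^n and every f ∈ L¹_loc(ℝ^n) with M_β(f) ∈ L¹_loc(ℝ^n). -/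
open MeasureTheory Metric ENNReal

/-- The uncentered fractional maximal function
`M_β(g)(x) = sup { r^β ⨍_{B(z,r)} g : x ∈ B(z,r) }` (with `M = M_0`),
taking values in `ℝ≥0∞`. -/
noncomputable def maximal {n : ℕ} (β : ℝ)
    (g : EuclideanSpace ℝ (Fin n) → ℝ≥0∞) (x : EuclideanSpace ℝ (Fin n)) : ℝ≥0∞ :=
  ⨆ (z : EuclideanSpace ℝ (Fin n)) (r : ℝ) (_ : 0 < r) (_ : x ∈ ball z r),
    ENNReal.ofReal (r ^ β) * ((∫⁻ y in ball z r, g y) / volume (ball z r))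

section Auxiliary

variable {n : ℕ}

local notation "E" => EuclideanSpace ℝ (Fin n)

/-- The normalising factor `s ^ β / |B(·, s)|` of the fractional average over a ball of
radius `s`. -/
noncomputable def fracWeight (n : ℕ) (β s : ℝ) : ℝ≥0∞ :=
  ENNReal.ofReal (s ^ (β - n)) * (volume (ball (0 : EuclideanSpace ℝ (Fin n)) 1))⁻¹

theorem volume_unit_ball_ne_zero : volume (ball (0 : E) 1) ≠ 0 :=
  (measure_ball_pos _ _ one_pos).ne'

theorem volume_unit_ball_ne_top : volume (ball (0 : E) 1) ≠ ⊤ :=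
  measure_ball_lt_top.ne

theorem volume_ball_eq_pow_mul (z : E) {s : ℝ} (hs : 0 < s) :
    volume (ball z s) = ENNReal.ofReal (s ^ n) * volume (ball (0 : E) 1) := by
  rw [Measure.addHaar_ball_of_pos _ _ hs, finrank_euclideanSpace_fin]

theorem ofReal_rpow_mul_div_volume_ball (β : ℝ) (z : E) {s : ℝ} (hs : 0 < s) (I : ℝ≥0∞) :
    ENNReal.ofReal (s ^ β) * (I / volume (ball z s)) = fracWeight n β s * I := by
  have hpos : 0 < s ^ n := pow_pos hs n
  rw [volume_ball_eq_pow_mul z hs, fracWeight, Real.rpow_sub hs, Real.rpow_natCast,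
    ENNReal.ofReal_div_of_pos hpos, div_eq_mul_inv, div_eq_mul_inv,
    ENNReal.mul_inv (Or.inr volume_unit_ball_ne_top) (Or.inl ENNReal.ofReal_ne_top)]
  ring

theorem fracWeight_mul_lintegral_le_maximal (β : ℝ) (g : E → ℝ≥0∞) {x z : E} {s : ℝ}
    (hs : 0 < s) (hx : x ∈ ball z s) :
    fracWeight n β s * ∫⁻ y in ball z s, g y ≤ maximal β g x := by
  rw [← ofReal_rpow_mul_div_volume_ball β z hs]
  exact le_iSup₂_of_le z s (le_iSup₂_of_le hs hx le_rfl)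

theorem maximal_congr_ae (β : ℝ) {g h : E → ℝ≥0∞} (hgh : g =ᵐ[volume] h) :
    maximal β g = maximal β h := by
  funext x
  simp only [maximal, lintegral_congr_ae (ae_restrict_of_ae hgh)]

theorem fracWeight_antitone {β : ℝ} (hβ : β < n) {s t : ℝ} (hs : 0 < s) (hst : s ≤ t) :
    fracWeight n β t ≤ fracWeight n β s := by
  unfold fracWeight
  gcongr ENNReal.ofReal ?_ * _
  exact Real.rpow_le_rpow_of_nonpos hs hst (by linarith)

theorem fracWeight_eq_three_rpow_mul (β : ℝ) {s : ℝ} (hs : 0 < s) :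
    fracWeight n β s = ENNReal.ofReal (3 ^ (n - β)) * fracWeight n β (3 * s) := by
  unfold fracWeight
  rw [← mul_assoc, ← ENNReal.ofReal_mul (by positivity),
    Real.mul_rpow (by norm_num) hs.le, ← mul_assoc, ← Real.rpow_add (by norm_num)]
  simp

theorem fracWeight_mul_volume_ball (β : ℝ) (z : E) {s : ℝ} (hs : 0 < s) :
    fracWeight n β s * volume (ball z (4 * s)) = ENNReal.ofReal (4 ^ n * s ^ β) := by
  rw [volume_ball_eq_pow_mul z (by positivity), fracWeight, mul_mul_mul_comm, mul_comm _⁻¹,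
    ← mul_assoc, mul_assoc, ENNReal.mul_inv_cancel volume_unit_ball_ne_zero
    volume_unit_ball_ne_top, mul_one, ← ENNReal.ofReal_mul (by positivity), mul_pow,
    Real.rpow_sub hs, Real.rpow_natCast]
  congr 1
  field_simp

theorem measurable_lintegral_ball {g : E → ℝ≥0∞} (hg : Measurable g) (ρ : ℝ) :
    Measurable fun y : E => ∫⁻ u in ball y ρ, g u := by
  have hS : MeasurableSet {p : E × E | dist p.2 p.1 < ρ} :=
    measurableSet_lt (by fun_prop) (by fun_prop)
  have := ((hg.comp measurable_snd).indicator hS).lintegral_prod_right' (ν := volume)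
  convert this using 2 with y
  rw [← lintegral_indicator measurableSet_ball]
  rfl

theorem lintegral_lintegral_ball_le {g : E → ℝ≥0∞} (hg : Measurable g) (z : E) (r ρ : ℝ) :
    ∫⁻ y in ball z r, ∫⁻ u in ball y ρ, g u ≤
      volume (ball (0 : E) ρ) * ∫⁻ u in ball z (r + ρ), g u := by
  have hS : MeasurableSet {p : E × E | dist p.2 p.1 < ρ} :=
    measurableSet_lt (by fun_prop) (by fun_prop)
  have hm : Measurable ({p : E × E | dist p.2 p.1 < ρ}.indicator (g ∘ Prod.snd)) :=
    (hg.comp measurable_snd).indicator hS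
  calc ∫⁻ y in ball z r, ∫⁻ u in ball y ρ, g u
      = ∫⁻ y in ball z r, ∫⁻ u, {p : E × E | dist p.2 p.1 < ρ}.indicator (g ∘ Prod.snd) (y, u) := by
        refine lintegral_congr fun y => ?_
        rw [← lintegral_indicator measurableSet_ball]
        rfl
    _ = ∫⁻ u, ∫⁻ y in ball z r, {p : E × E | dist p.2 p.1 < ρ}.indicator (g ∘ Prod.snd) (y, u) :=
        lintegral_lintegral_swap hm.aemeasurable
    _ ≤ ∫⁻ u, (ball z (r + ρ)).indicator (fun u => volume (ball (0 : E) ρ) * g u) u := by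
        refine lintegral_mono fun u => ?_
        by_cases hu : u ∈ ball z (r + ρ)
        · rw [Set.indicator_of_mem hu]
          calc ∫⁻ y in ball z r, {p : E × E | dist p.2 p.1 < ρ}.indicator (g ∘ Prod.snd) (y, u)
              ≤ ∫⁻ y, {p : E × E | dist p.2 p.1 < ρ}.indicator (g ∘ Prod.snd) (y, u) :=
                setLIntegral_le_lintegral _ _
            _ = ∫⁻ y, (ball u ρ).indicator (fun _ => g u) y := by
                refine lintegral_congr fun y => ?_
                simp only [Set.indicator, Set.mem_ofPred_eq, mem_ball, dist_comm u y,
                  Function.comp_apply]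
            _ = volume (ball (0 : E) ρ) * g u := by
                rw [lintegral_indicator_const measurableSet_ball,
                  Measure.addHaar_ball_center, mul_comm]
        · rw [Set.indicator_of_notMem hu, nonpos_iff_eq_zero]
          refine setLIntegral_eq_zero measurableSet_ball fun y hy => ?_
          refine Set.indicator_of_notMem (fun h => hu ?_) _
          have h1 : dist u y < ρ := h
          have h2 : dist y z < r := hy
          have h3 := dist_triangle u y z
          exact mem_ball.2 (by linarith)
    _ = volume (ball (0 : E) ρ) * ∫⁻ u in ball z (r + ρ), g u := by
        rw [lintegral_indicator measurableSet_ball, lintegral_const_mul _ hg]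

/-- At a point of `B(z, r)`, the fractional maximal function is controlled by its value at any
other point of that ball (large radii) plus a dyadic potential (small radii). -/
theorem maximal_le_add_tsum {β : ℝ} (hβ : β < n) (g : E → ℝ≥0∞) {x y z : E} {r : ℝ}
    (hr : 0 < r) (hx : x ∈ ball z r) (hy : y ∈ ball z r) :
    maximal β g y ≤ ENNReal.ofReal (3 ^ (n - β)) * maximal β g x +
      ∑' k : ℕ, fracWeight n β ((1 / 2) ^ (k + 1) * r) *
        ∫⁻ u in ball y (4 * ((1 / 2) ^ (k + 1) * r)), g u := by
  refine iSup₂_le fun w s => iSup₂_le fun hs hyw => ?_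
  rw [ofReal_rpow_mul_div_volume_ball β w hs]
  rw [mem_ball] at hx hy hyw
  rcases le_or_gt r s with hrs | hsr
  · refine le_add_right ?_
    rw [fracWeight_eq_three_rpow_mul β hs, mul_assoc]
    gcongr
    refine le_trans ?_ (fracWeight_mul_lintegral_le_maximal β g (z := w) (s := 3 * s)
      (by positivity) ?_)
    · gcongr
      linarith
    · have h1 := dist_triangle x z y
      have h2 := dist_triangle x y w
      rw [dist_comm z y] at h1
      exact mem_ball.2 (by linarith)
  · refine le_add_left ?_
    obtain ⟨k, hk1, hk2⟩ := exists_nat_pow_near_of_lt_one (div_pos hs hr)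
      ((div_le_one hr).2 hsr.le) (y := (1 / 2 : ℝ)) (by norm_num) (by norm_num)
    rw [lt_div_iff₀ hr] at hk1
    rw [div_le_iff₀ hr] at hk2
    refine le_trans ?_ (ENNReal.le_tsum k)
    gcongr
    · exact fracWeight_antitone hβ (by positivity) hk1.le
    · refine ball_subset_ball' ?_
      rw [dist_comm, pow_succ]
      linarith

theorem tsum_ofReal_half_rpow_ne_top (n : ℕ) {β : ℝ} (hβ : 0 < β) :
    ∑' k : ℕ, ENNReal.ofReal (4 ^ n * ((1 / 2 : ℝ) ^ (k + 1)) ^ β) ≠ ⊤ := by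
  have hq : (1 / 2 : ℝ) ^ β < 1 := Real.rpow_lt_one (by norm_num) (by norm_num) hβ
  have hs : Summable fun k : ℕ => 4 ^ n * ((1 / 2 : ℝ) ^ (k + 1)) ^ β := by
    refine Summable.mul_left _ ?_
    have := (summable_nat_add_iff 1).2 (summable_geometric_of_lt_one (by positivity) hq)
    refine this.congr fun k => ?_
    rw [← Real.rpow_natCast, ← Real.rpow_natCast, ← Real.rpow_mul (by norm_num),
      ← Real.rpow_mul (by norm_num), mul_comm]
  exact hs.tsum_ofReal_ne_top

theorem maximal_zero_maximal_le {β : ℝ} (hβ : β < n) {g : E → ℝ≥0∞} (hg : Measurable g) (x : E) :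
    maximal 0 (maximal β g) x ≤
      ENNReal.ofReal (3 ^ (n - β)) *
        (1 + ∑' k : ℕ, ENNReal.ofReal (4 ^ n * ((1 / 2 : ℝ) ^ (k + 1)) ^ β)) *
          maximal β g x := by
  set S := ∑' k : ℕ, ENNReal.ofReal (4 ^ n * ((1 / 2 : ℝ) ^ (k + 1)) ^ β) with hS
  set T := ENNReal.ofReal ((3 : ℝ) ^ (n - β))
  refine iSup₂_le fun z r => iSup₂_le fun hr hx => ?_
  have hterm : ∀ k : ℕ, ∫⁻ y in ball z r, fracWeight n β ((1 / 2) ^ (k + 1) * r) *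
        ∫⁻ u in ball y (4 * ((1 / 2) ^ (k + 1) * r)), g u ≤
      ENNReal.ofReal (4 ^ n * ((1 / 2 : ℝ) ^ (k + 1)) ^ β) *
        (ENNReal.ofReal (r ^ β) * ∫⁻ u in ball z (3 * r), g u) := by
    intro k
    rw [lintegral_const_mul _ (measurable_lintegral_ball hg _)]
    calc _ ≤ fracWeight n β ((1 / 2) ^ (k + 1) * r) *
          (volume (ball (0 : E) (4 * ((1 / 2) ^ (k + 1) * r))) *
            ∫⁻ u in ball z (3 * r), g u) := by
          gcongr
          refine (lintegral_lintegral_ball_le hg _ _ _).trans ?_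
          gcongr
          have : (1 / 2 : ℝ) ^ k ≤ 1 := pow_le_one₀ (by norm_num) (by norm_num)
          rw [pow_succ]
          nlinarith
      _ = _ := by
          rw [← mul_assoc, fracWeight_mul_volume_ball β 0 (by positivity), ← mul_assoc,
            ← ENNReal.ofReal_mul (by positivity), Real.mul_rpow (by positivity) hr.le, mul_assoc]
  have hint : ∫⁻ y in ball z r, maximal β g y ≤ T * maximal β g x * volume (ball z r) +
      S * (ENNReal.ofReal (r ^ β) * ∫⁻ u in ball z (3 * r), g u) := by
    refine (setLIntegral_mono' measurableSet_ball
      fun y hy => maximal_le_add_tsum hβ g hr hx hy).trans ?_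
    rw [lintegral_add_left measurable_const, setLIntegral_const,
      lintegral_tsum fun k => ((measurable_lintegral_ball hg _).const_mul _).aemeasurable, hS,
      ← ENNReal.tsum_mul_right]
    gcongr with k
    exact hterm k
  have hv0 : volume (ball z r) ≠ 0 := (measure_ball_pos _ _ hr).ne'
  have hvt : volume (ball z r) ≠ ⊤ := measure_ball_lt_top.ne
  have hfar : ENNReal.ofReal (r ^ β) * ((∫⁻ u in ball z (3 * r), g u) / volume (ball z r)) ≤
      T * maximal β g x := by
    rw [ofReal_rpow_mul_div_volume_ball β z hr, fracWeight_eq_three_rpow_mul β hr, mul_assoc]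
    gcongr
    exact fracWeight_mul_lintegral_le_maximal β g (by positivity)
      (ball_subset_ball (by linarith) hx)
  rw [Real.rpow_zero, ENNReal.ofReal_one, one_mul]
  calc (∫⁻ y in ball z r, maximal β g y) / volume (ball z r)
      ≤ (T * maximal β g x * volume (ball z r) +
          S * (ENNReal.ofReal (r ^ β) * ∫⁻ u in ball z (3 * r), g u)) / volume (ball z r) := by
        gcongr
    _ = T * maximal β g x + S * (ENNReal.ofReal (r ^ β) *
          ((∫⁻ u in ball z (3 * r), g u) / volume (ball z r))) := by
        rw [ENNReal.add_div, ENNReal.mul_div_cancel_right hv0 hvt, mul_div_assoc, mul_div_assoc]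
    _ ≤ T * maximal β g x + S * (T * maximal β g x) := by gcongr
    _ = T * (1 + S) * maximal β g x := by ring

end Auxiliary

/-- **Lemma 2.2**: for `0 < β < n` there is `c = c(n,β) > 0` such that
`M(M_β(f)) ≤ c M_β(f)` pointwise, for every `f ∈ L¹_loc(ℝⁿ)` with `M_β(f) ∈ L¹_loc(ℝⁿ)`. -/
theorem maximal_comp_bound (n : ℕ) (hn : 2 ≤ n) (β : ℝ) (hβ₀ : 0 < β) (hβn : β < n) :
    ∃ c : ℝ, 0 < c ∧
      ∀ f : EuclideanSpace ℝ (Fin n) → ℝ,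
        LocallyIntegrable f →
        (∀ K : Set (EuclideanSpace ℝ (Fin n)), IsCompact K →
          ∫⁻ x in K, maximal β (fun z => ENNReal.ofReal |f z|) x < ⊤) →
        ∀ x, maximal 0 (maximal β fun z => ENNReal.ofReal |f z|) x
          ≤ ENNReal.ofReal c * maximal β (fun z => ENNReal.ofReal |f z|) x := by
  set C : ℝ≥0∞ := ENNReal.ofReal (3 ^ (n - β)) *
    (1 + ∑' k : ℕ, ENNReal.ofReal (4 ^ n * ((1 / 2 : ℝ) ^ (k + 1)) ^ β))
  have hCt : C ≠ ⊤ := ENNReal.mul_ne_top ENNReal.ofReal_ne_top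
    (ENNReal.add_ne_top.2 ⟨ENNReal.one_ne_top, tsum_ofReal_half_rpow_ne_top n hβ₀⟩)
  have hC0 : C ≠ 0 := mul_ne_zero (ENNReal.ofReal_pos.2 (by positivity)).ne' (by simp)
  refine ⟨C.toReal, ENNReal.toReal_pos hC0 hCt, fun f hf _ x => ?_⟩
  have hm : AEMeasurable (fun z => ENNReal.ofReal |f z|) volume :=
    hf.aestronglyMeasurable.aemeasurable.abs.ennreal_ofReal
  rw [ENNReal.ofReal_toReal hCt, maximal_congr_ae β hm.ae_eq_mk]
  exact maximal_zero_maximal_le hβn hm.measurable_mk x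
end

section
/- Let n ≥ 2, let Ω ⊂ ℝ^n be open, let f ∈ L¹_loc(Ω) and g ∈ L^{1+ε₀}_loc(Ω) for some ε₀ > 0, both nonnegative. Assume there exist κ ∈ (0,1), A > 0 and R₀ > 0 such that the reverse Hölder inequality ⨍_{B_R} f ≤ A ( ⨍_{B_{3R}} f^κ )^{1/κ} + ⨍_{B_{3R}} g holds for every ball B_{3R} compactly contained in Ω with R ≤ R₀ that additionally satisfies ⨍_{B_{3R}} f ≤ ⨍_{B_R} f. Then there exists c* = c*(n,A,ε₀) > 0 such that whenever 0 < ε ≤ min{(1−κ)/c*, ε₀}, one has f ∈ L^{1+ε}_loc(Ω); moreover there exists c = c(n,A,ε₀) such that for any such ε, ( ⨍_{B_R} f^{1+ε} )^{1/(1+ε)} ≤ c ⨍_{B_{3R}} f + c ( ⨍_{B_{3R}} g^{1+ε} )^{1/(1+ε)} whenever B_{3R} ⊂⊂ Ω and R ≤ R₀. Furthermore, the constant c* can be chosen monotone increasing with respect to ε₀. -/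
open MeasureTheory Metric ENNReal Set

theorem setLIntegral_ofReal_le_superlevel_add {α : Type*} [MeasurableSpace α] {μ : Measure α}
    (B : Set α) {h : α → ℝ} (hh : Measurable h) (s : ℝ) :
    ∫⁻ x in B, ENNReal.ofReal (h x) ∂μ ≤
      ∫⁻ x in B ∩ {x | s < h x}, ENNReal.ofReal (h x) ∂μ + ENNReal.ofReal s * μ B := by
  have hS : MeasurableSet {x | s < h x} := measurableSet_lt measurable_const hh
  rw [← lintegral_inter_add_sdiff (μ := μ) (fun x => ENNReal.ofReal (h x)) B hS]
  gcongr
  calc ∫⁻ x in B \ {x | s < h x}, ENNReal.ofReal (h x) ∂μ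
      ≤ ∫⁻ x in B \ {x | s < h x}, ENNReal.ofReal s ∂μ := by
        refine lintegral_mono_ae ?_
        have : ∀ᵐ x ∂(μ.restrict {x | s < h x}ᶜ), h x ≤ s := by
          filter_upwards [ae_restrict_mem hS.compl] with x hx
          simpa using hx
        have h2 := ae_mono (Measure.restrict_mono_set μ
          (show B \ {x | s < h x} ⊆ {x | s < h x}ᶜ from fun x hx => hx.2)) this
        filter_upwards [h2] with x hx
        exact ENNReal.ofReal_le_ofReal hx
    _ = ENNReal.ofReal s * μ (B \ {x | s < h x}) := by simp
    _ ≤ ENNReal.ofReal s * μ B := by gcongr; exact sdiff_subset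

theorem ENNReal.ofReal_sub_mul_le {a b : ℝ} (hb : 0 ≤ b) {V X : ℝ≥0∞} (hV : V ≠ ⊤)
    (h : ENNReal.ofReal a * V ≤ X + ENNReal.ofReal b * V) : ENNReal.ofReal (a - b) * V ≤ X := by
  rw [ENNReal.ofReal_sub _ hb, ENNReal.sub_mul (fun _ _ => hV)]
  exact tsub_le_iff_right.2 h

theorem ofReal_mul_measure_le_of_reverseHolder {α : Type*} [MeasurableSpace α] {μ : Measure α}
    {B : Set α} (hB₀ : μ B ≠ 0) (hB : μ B ≠ ⊤) {f g : α → ℝ} (hf : Measurable f)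
    (hg : Measurable g) (hf₀ : ∀ x, 0 ≤ f x) {A κ t : ℝ} (hA : 1 ≤ A)
    (hκ : 1 / 2 ≤ κ) (hκ₁ : κ < 1) (ht : 0 < t)
    (h : ENNReal.ofReal t ≤
      ENNReal.ofReal A * ((∫⁻ x in B, ENNReal.ofReal (f x ^ κ) ∂μ) / μ B) ^ (1 / κ) +
        (∫⁻ x in B, ENNReal.ofReal (g x) ∂μ) / μ B) :
    ENNReal.ofReal t * μ B ≤
      ENNReal.ofReal (4 * A * t ^ (1 - κ)) *
          ∫⁻ x in B ∩ {x | t / (8 * A) < f x}, ENNReal.ofReal (f x ^ κ) ∂μ +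
        4 * ∫⁻ x in B ∩ {x | t / 4 < g x}, ENNReal.ofReal (g x) ∂μ := by
  have hκ₀ : 0 < κ := by linarith
  have hA₀ : 0 < A := by linarith
  have key : ENNReal.ofReal (t / 2) ≤
      ENNReal.ofReal A * ((∫⁻ x in B, ENNReal.ofReal (f x ^ κ) ∂μ) / μ B) ^ (1 / κ) ∨
      ENNReal.ofReal (t / 2) ≤ (∫⁻ x in B, ENNReal.ofReal (g x) ∂μ) / μ B := by
    by_contra! hcon
    have := ENNReal.add_lt_add hcon.1 hcon.2
    rw [← ENNReal.ofReal_add (by positivity) (by positivity), add_halves] at this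
    exact absurd h (not_le.2 this)
  rcases key with h1 | h1
  · refine le_trans ?_ le_self_add
    have h2 : ENNReal.ofReal (t / (2 * A)) ≤
        ((∫⁻ x in B, ENNReal.ofReal (f x ^ κ) ∂μ) / μ B) ^ (1 / κ) := by
      have : t / 2 = A * (t / (2 * A)) := by field_simp
      rw [this, ENNReal.ofReal_mul hA₀.le] at h1
      exact (ENNReal.mul_le_mul_iff_right (by simpa using hA₀) ENNReal.ofReal_ne_top).1 h1
    have h3 : ENNReal.ofReal ((t / (2 * A)) ^ κ) ≤
        (∫⁻ x in B, ENNReal.ofReal (f x ^ κ) ∂μ) / μ B := by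
      rw [← ENNReal.ofReal_rpow_of_pos (by positivity)]
      rwa [one_div, ENNReal.le_rpow_inv_iff hκ₀] at h2
    rw [ENNReal.le_div_iff_mul_le (Or.inl hB₀) (Or.inl hB)] at h3
    have h4 := h3.trans (setLIntegral_ofReal_le_superlevel_add B (hf.pow_const κ)
      ((t / (8 * A)) ^ κ))
    have hset : {x | (t / (8 * A)) ^ κ < f x ^ κ} = {x | t / (8 * A) < f x} := by
      ext x
      exact Real.rpow_lt_rpow_iff (by positivity) (hf₀ x) hκ₀
    rw [hset] at h4
    have h5 := ENNReal.ofReal_sub_mul_le (by positivity) hB h4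
    have h6 : 2 * (t / (8 * A)) ^ κ ≤ (t / (2 * A)) ^ κ := by
      have e : t / (2 * A) = 4 * (t / (8 * A)) := by field_simp; ring
      rw [e, Real.mul_rpow (by norm_num) (by positivity)]
      gcongr
      calc (2 : ℝ) = 4 ^ (1 / 2 : ℝ) := by
            rw [show (4 : ℝ) = 2 ^ (2 : ℝ) by norm_num, ← Real.rpow_mul (by norm_num)]; norm_num
        _ ≤ 4 ^ κ := Real.rpow_le_rpow_of_exponent_le (by norm_num) hκ
    have h7 : t ≤ 4 * A * t ^ (1 - κ) * ((t / (2 * A)) ^ κ - (t / (8 * A)) ^ κ) := by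
      have e1 : (2 * A) ^ κ ≤ 2 * A := by
        conv_rhs => rw [← Real.rpow_one (2 * A)]
        exact Real.rpow_le_rpow_of_exponent_le (by linarith) hκ₁.le
      have e2 : t = t ^ (1 - κ) * ((2 * A) ^ κ * (t / (2 * A)) ^ κ) := by
        rw [← Real.mul_rpow (by positivity) (by positivity), mul_div_cancel₀ _ (by positivity),
          ← Real.rpow_add ht]
        simp
      have e3 : 0 ≤ (t / (2 * A)) ^ κ := by positivity
      have e4 : 0 ≤ t ^ (1 - κ) := by positivity
      calc t = t ^ (1 - κ) * ((2 * A) ^ κ * (t / (2 * A)) ^ κ) := e2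
        _ ≤ t ^ (1 - κ) * ((2 * A) * (t / (2 * A)) ^ κ) := by gcongr
        _ ≤ t ^ (1 - κ) * ((2 * A) * (2 * ((t / (2 * A)) ^ κ - (t / (8 * A)) ^ κ))) := by
            gcongr; linarith
        _ = _ := by ring
    calc ENNReal.ofReal t * μ B
        ≤ ENNReal.ofReal (4 * A * t ^ (1 - κ) * ((t / (2 * A)) ^ κ - (t / (8 * A)) ^ κ)) * μ B := by
          gcongr
      _ = ENNReal.ofReal (4 * A * t ^ (1 - κ)) *
            (ENNReal.ofReal ((t / (2 * A)) ^ κ - (t / (8 * A)) ^ κ) * μ B) := by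
          rw [ENNReal.ofReal_mul (by positivity), mul_assoc]
      _ ≤ _ := by gcongr
  · refine le_trans ?_ le_add_self
    rw [ENNReal.le_div_iff_mul_le (Or.inl hB₀) (Or.inl hB)] at h1
    have h4 := h1.trans (setLIntegral_ofReal_le_superlevel_add B hg (t / 4))
    have h5 := ENNReal.ofReal_sub_mul_le (by positivity) hB h4
    calc ENNReal.ofReal t * μ B = 4 * (ENNReal.ofReal (t / 2 - t / 4) * μ B) := by
          rw [← mul_assoc, show (4 : ℝ≥0∞) = ENNReal.ofReal 4 by simp,
            ← ENNReal.ofReal_mul (by norm_num)]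
          congr 2; ring
      _ ≤ _ := by gcongr

theorem measure_le_of_forall_closedBall_le {X : Type*} [MetricSpace X]
    [SecondCountableTopology X] [MeasurableSpace X] [OpensMeasurableSpace X]
    (ν Ψ : Measure X) {S U : Set X} {δ : ℝ}
    (h : ∀ x ∈ S, ∃ ρ : ℝ, 0 < ρ ∧ ρ ≤ δ ∧ closedBall x ρ ⊆ U ∧
      ν (closedBall x (5 * ρ)) ≤ Ψ (closedBall x ρ)) :
    ν S ≤ Ψ U := by
  choose! ρ hρ hρδ hρU hν using h
  obtain ⟨u, huS, hdisj, hcov⟩ := Vitali.exists_disjoint_subfamily_covering_enlargement_closedBall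
    S id ρ δ hρδ 5 (by norm_num)
  have hu : u.Countable := hdisj.countable_of_nonempty_interior fun x hx =>
    ⟨x, ball_subset_interior_closedBall (mem_ball_self (hρ x (huS hx)))⟩
  calc ν S ≤ ν (⋃ x ∈ u, closedBall x (5 * ρ x)) := by
        refine measure_mono fun x hx => ?_
        obtain ⟨y, hy, hxy⟩ := hcov x hx
        exact mem_biUnion hy (hxy (mem_closedBall_self (hρ x hx).le))
    _ ≤ ∑' x : u, ν (closedBall (x : X) (5 * ρ x)) := measure_biUnion_le ν hu _
    _ ≤ ∑' x : u, Ψ (closedBall (x : X) (ρ x)) := ENNReal.tsum_le_tsum fun x => hν x (huS x.2)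
    _ = Ψ (⋃ x ∈ u, closedBall x (ρ x)) :=
        (measure_biUnion hu hdisj fun x _ => measurableSet_closedBall).symm
    _ ≤ Ψ U := measure_mono (iUnion₂_subset fun x hx => hρU x (huS hx))

theorem lintegral_mul_min_rpow_le {α : Type*} [MeasurableSpace α] {μ : Measure α} {B B' : Set α}
    {f g : α → ℝ} (hf : Measurable f) (hg : Measurable g)
    (hf₀ : ∀ x, 0 ≤ f x) (hg₀ : ∀ x, 0 ≤ g x) {C : ℝ≥0∞} {K κ ε t₀ N : ℝ} (hK : 1 ≤ K)
    (hκ : 0 < κ) (hκ₁ : κ < 1) (hε : 0 < ε) (hε₁ : ε ≤ 1) (ht₀ : 0 ≤ t₀) (hN : 0 < N)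
    (h : ∀ t : ℝ, 0 < t → t₀ ≤ t →
      ∫⁻ x in B ∩ {x | t < f x}, ENNReal.ofReal (f x) ∂μ ≤
        C * (ENNReal.ofReal (t ^ (1 - κ)) *
            ∫⁻ x in B' ∩ {x | t / K < f x}, ENNReal.ofReal (f x ^ κ) ∂μ +
          ∫⁻ x in B' ∩ {x | t / 4 < g x}, ENNReal.ofReal (g x) ∂μ)) :
    ∫⁻ x in B, ENNReal.ofReal (f x * min (f x) N ^ ε) ∂μ ≤
      ENNReal.ofReal (t₀ ^ ε) * ∫⁻ x in B, ENNReal.ofReal (f x) ∂μ +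
        C * (ENNReal.ofReal (K ^ 2 * (ε / (1 - κ))) *
            ∫⁻ x in B', ENNReal.ofReal (f x * min (f x) N ^ ε) ∂μ +
          4 * ∫⁻ x in B', ENNReal.ofReal (g x ^ (1 + ε)) ∂μ) := by
  have hK₀ : 0 < K := by linarith
  have hm₀ : ∀ x, 0 ≤ min (f x) N := fun x => le_min (hf₀ x) hN.le
  have hmm : Measurable fun x => min (f x) N := hf.min measurable_const
  set ν : Measure α := (μ.restrict B).withDensity fun x => ENNReal.ofReal (f x)
  set P : Measure α := (μ.restrict B').withDensity fun x => ENNReal.ofReal (f x ^ κ)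
  set Q : Measure α := (μ.restrict B').withDensity fun x => ENNReal.ofReal (g x)
  have hνS : ∀ t, ν {x | t < f x} = ∫⁻ x in B ∩ {x | t < f x}, ENNReal.ofReal (f x) ∂μ := by
    intro t
    have hS := measurableSet_lt (measurable_const (a := t)) hf
    rw [withDensity_apply _ hS, Measure.restrict_restrict hS, inter_comm]
  have hPS : ∀ t, P {x | t < f x} =
      ∫⁻ x in B' ∩ {x | t < f x}, ENNReal.ofReal (f x ^ κ) ∂μ := by
    intro t
    have hS := measurableSet_lt (measurable_const (a := t)) hf
    rw [withDensity_apply _ hS, Measure.restrict_restrict hS, inter_comm]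
  have hQS : ∀ t, Q {x | t < g x} = ∫⁻ x in B' ∩ {x | t < g x}, ENNReal.ofReal (g x) ∂μ := by
    intro t
    have hS := measurableSet_lt (measurable_const (a := t)) hg
    rw [withDensity_apply _ hS, Measure.restrict_restrict hS, inter_comm]
  simp only [← hνS, ← hPS, ← hQS] at h
  have hνint : ∀ w : α → ℝ, Measurable w → ∫⁻ x, ENNReal.ofReal (w x) ∂ν =
      ∫⁻ x in B, ENNReal.ofReal (f x * w x) ∂μ := fun w hw => by
    rw [lintegral_withDensity_eq_lintegral_mul _ hf.ennreal_ofReal hw.ennreal_ofReal]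
    simp only [Pi.mul_apply, ENNReal.ofReal_mul (hf₀ _)]
  have hPint : ∀ w : α → ℝ, Measurable w → ∫⁻ x, ENNReal.ofReal (w x) ∂P =
      ∫⁻ x in B', ENNReal.ofReal (f x ^ κ * w x) ∂μ := fun w hw => by
    rw [lintegral_withDensity_eq_lintegral_mul _ (hf.pow_const κ).ennreal_ofReal hw.ennreal_ofReal]
    simp only [Pi.mul_apply, ENNReal.ofReal_mul (Real.rpow_nonneg (hf₀ _) κ)]
  have hQint : ∀ w : α → ℝ, Measurable w → ∫⁻ x, ENNReal.ofReal (w x) ∂Q =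
      ∫⁻ x in B', ENNReal.ofReal (g x * w x) ∂μ := fun w hw => by
    rw [lintegral_withDensity_eq_lintegral_mul _ hg.ennreal_ofReal hw.ennreal_ofReal]
    simp only [Pi.mul_apply, ENNReal.ofReal_mul (hg₀ _)]
  have hp : 0 < 1 + ε - κ := by linarith
  have key : ∀ t : ℝ, 0 < t →
      ν {x | t < min (f x) N} * ENNReal.ofReal (t ^ (ε - 1)) ≤
        ν {_x | t < t₀} * ENNReal.ofReal (t ^ (ε - 1)) +
          C * (P {x | t < K * min (f x) N} * ENNReal.ofReal (t ^ (1 + ε - κ - 1)) +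
            Q {x | t < 4 * g x} * ENNReal.ofReal (t ^ (ε - 1))) := by
    intro t ht
    rcases lt_or_ge t t₀ with htt | htt
    · refine le_trans ?_ le_self_add
      gcongr ?_ * _
      exact measure_mono fun x _ => htt
    refine le_trans ?_ le_add_self
    rcases lt_or_ge t N with htN | htN
    · have e1 : {x | t < min (f x) N} = {x | t < f x} := by
        ext x; simp [htN]
      have e2 : {x | t < K * min (f x) N} = {x | t / K < f x} := by
        ext x
        have h1 : t / K < N := (div_le_self ht.le hK).trans_lt htN
        rw [mem_ofPred_eq, mem_ofPred_eq, mul_comm, ← div_lt_iff₀ hK₀, lt_min_iff]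
        exact and_iff_left h1
      have e3 : {x | t < 4 * g x} = {x | t / 4 < g x} := by
        ext x
        rw [mem_ofPred_eq, mem_ofPred_eq, mul_comm, ← div_lt_iff₀ (by norm_num)]
      rw [e1, e2, e3]
      calc ν {x | t < f x} * ENNReal.ofReal (t ^ (ε - 1))
          ≤ (C * (ENNReal.ofReal (t ^ (1 - κ)) * P {x | t / K < f x} + Q {x | t / 4 < g x})) *
              ENNReal.ofReal (t ^ (ε - 1)) := by gcongr; exact h t ht htt
        _ = _ := by
          rw [show 1 + ε - κ - 1 = (1 - κ) + (ε - 1) by ring, Real.rpow_add ht,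
            ENNReal.ofReal_mul (by positivity)]
          ring
    · have e1 : {x | t < min (f x) N} = ∅ := by
        ext x; simp [htN]
      rw [e1, measure_empty, zero_mul]
      exact zero_le
  have hmeas : ∀ (m : Measure α) (w : α → ℝ), Measurable fun t : ℝ => m {x | t < w x} :=
    fun m w => Antitone.measurable fun s t hst =>
      measure_mono fun x (hx : t < w x) => lt_of_le_of_lt hst hx
  have hpow : ∀ p : ℝ, Measurable fun t : ℝ => ENNReal.ofReal (t ^ p) :=
    fun p => (measurable_id.pow_const p).ennreal_ofReal
  rw [← hνint _ (hmm.pow_const ε), lintegral_rpow_eq_lintegral_meas_lt_mul ν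
    (Filter.Eventually.of_forall hm₀) hmm.aemeasurable hε]
  calc ENNReal.ofReal ε *
        ∫⁻ t in Ioi 0, ν {x | t < min (f x) N} * ENNReal.ofReal (t ^ (ε - 1))
      ≤ ENNReal.ofReal ε * ∫⁻ t in Ioi 0, (ν {_x | t < t₀} * ENNReal.ofReal (t ^ (ε - 1)) +
          C * (P {x | t < K * min (f x) N} * ENNReal.ofReal (t ^ (1 + ε - κ - 1)) +
            Q {x | t < 4 * g x} * ENNReal.ofReal (t ^ (ε - 1)))) := by
        gcongr _ * ?_
        exact setLIntegral_mono' measurableSet_Ioi fun t ht => key t ht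
    _ = ENNReal.ofReal ε * (∫⁻ t in Ioi 0, ν {_x | t < t₀} * ENNReal.ofReal (t ^ (ε - 1))) +
          C * (ENNReal.ofReal ε * (∫⁻ t in Ioi 0,
              P {x | t < K * min (f x) N} * ENNReal.ofReal (t ^ (1 + ε - κ - 1))) +
            ENNReal.ofReal ε *
              (∫⁻ t in Ioi 0, Q {x | t < 4 * g x} * ENNReal.ofReal (t ^ (ε - 1)))) := by
        have m1 : Measurable fun t : ℝ => ν {_x | t < t₀} * ENNReal.ofReal (t ^ (ε - 1)) :=
          (hmeas ν fun _ => t₀).mul (hpow _)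
        have m2 : Measurable fun t : ℝ =>
            P {x | t < K * min (f x) N} * ENNReal.ofReal (t ^ (1 + ε - κ - 1)) :=
          (hmeas P _).mul (hpow _)
        have m3 : Measurable fun t : ℝ => Q {x | t < 4 * g x} * ENNReal.ofReal (t ^ (ε - 1)) :=
          (hmeas Q _).mul (hpow _)
        rw [lintegral_add_left m1, lintegral_const_mul C (f := fun t : ℝ =>
          P {x | t < K * min (f x) N} * ENNReal.ofReal (t ^ (1 + ε - κ - 1)) +
            Q {x | t < 4 * g x} * ENNReal.ofReal (t ^ (ε - 1))) (m2.add m3),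
          lintegral_add_left m2]
        ring
    _ ≤ _ := by
        gcongr ?_ + C * (?_ + ?_)
        · rw [← lintegral_rpow_eq_lintegral_meas_lt_mul ν (f := fun _ => t₀)
            (Filter.Eventually.of_forall fun _ => ht₀) aemeasurable_const hε,
            hνint _ measurable_const, ← lintegral_const_mul _ hf.ennreal_ofReal]
          refine lintegral_mono fun x => le_of_eq ?_
          rw [ENNReal.ofReal_mul (hf₀ x), mul_comm]
        · have e : ENNReal.ofReal ε =
              ENNReal.ofReal (ε / (1 + ε - κ)) * ENNReal.ofReal (1 + ε - κ) := by
            rw [← ENNReal.ofReal_mul (by positivity), div_mul_cancel₀ _ hp.ne']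
          rw [e, mul_assoc, ← lintegral_rpow_eq_lintegral_meas_lt_mul P
            (f := fun x => K * min (f x) N)
            (Filter.Eventually.of_forall fun x => mul_nonneg hK₀.le (hm₀ x))
            (hmm.const_mul K).aemeasurable hp, hPint _ ((hmm.const_mul K).pow_const _),
            ← lintegral_const_mul _ (by fun_prop), ← lintegral_const_mul _ (by fun_prop)]
          refine lintegral_mono fun x => ?_
          have hx := hf₀ x
          have hmx := hm₀ x
          have h1κ : 0 < 1 - κ := by linarith
          simp only
          rw [← ENNReal.ofReal_mul (by positivity), ← ENNReal.ofReal_mul (by positivity)]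
          apply ENNReal.ofReal_le_ofReal
          have a1 : ε / (1 + ε - κ) ≤ ε / (1 - κ) := by gcongr; linarith
          have a2 : K ^ (1 + ε - κ) ≤ K ^ 2 := by
            rw [← Real.rpow_natCast]
            exact Real.rpow_le_rpow_of_exponent_le hK (by push_cast; linarith)
          have a3 : min (f x) N ^ (1 - κ) ≤ f x ^ (1 - κ) :=
            Real.rpow_le_rpow hmx (min_le_left _ _) h1κ.le
          have a4 : f x ^ κ * f x ^ (1 - κ) = f x := by
            rw [← Real.rpow_add_of_nonneg hx hκ.le h1κ.le]; simp
          calc ε / (1 + ε - κ) * (f x ^ κ * (K * min (f x) N) ^ (1 + ε - κ))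
              = ε / (1 + ε - κ) * (f x ^ κ * (K ^ (1 + ε - κ) *
                  (min (f x) N ^ (1 - κ) * min (f x) N ^ ε))) := by
                rw [Real.mul_rpow hK₀.le hmx, ← Real.rpow_add_of_nonneg hmx h1κ.le hε.le]
                congr 4; ring
            _ ≤ ε / (1 - κ) * (f x ^ κ * (K ^ 2 * (f x ^ (1 - κ) * min (f x) N ^ ε))) := by
                gcongr
            _ = K ^ 2 * (ε / (1 - κ)) * ((f x ^ κ * f x ^ (1 - κ)) * min (f x) N ^ ε) := by ring
            _ = _ := by rw [a4]
        · rw [← lintegral_rpow_eq_lintegral_meas_lt_mul Q (f := fun x => 4 * g x)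
            (Filter.Eventually.of_forall fun x => mul_nonneg (by norm_num) (hg₀ x))
            (hg.const_mul 4).aemeasurable hε, hQint _ ((hg.const_mul 4).pow_const _),
            ← lintegral_const_mul _ (by fun_prop)]
          refine lintegral_mono fun x => ?_
          have hx := hg₀ x
          simp only
          rw [show (4 : ℝ≥0∞) = ENNReal.ofReal 4 by simp, ← ENNReal.ofReal_mul (by norm_num)]
          apply ENNReal.ofReal_le_ofReal
          have a1 : (4 : ℝ) ^ ε ≤ 4 := by
            conv_rhs => rw [← Real.rpow_one 4]
            exact Real.rpow_le_rpow_of_exponent_le (by norm_num) hε₁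
          rw [Real.mul_rpow (by norm_num) hx, Real.rpow_add_of_nonneg hx zero_le_one hε.le,
            Real.rpow_one]
          calc g x * (4 ^ ε * g x ^ ε) = 4 ^ ε * (g x * g x ^ ε) := by ring
            _ ≤ _ := by gcongr

theorem rpow_laverage_le_of_exponent_le {α : Type*} [MeasurableSpace α] {μ : Measure α}
    {B : Set α} (hB₀ : μ B ≠ 0) (hB : μ B ≠ ⊤) {f : α → ℝ} (hf : Measurable f)
    (hf₀ : ∀ x, 0 ≤ f x) {p q : ℝ} (hp : 0 < p) (hpq : p ≤ q) :
    ((∫⁻ x in B, ENNReal.ofReal (f x ^ p) ∂μ) / μ B) ^ (1 / p) ≤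
      ((∫⁻ x in B, ENNReal.ofReal (f x ^ q) ∂μ) / μ B) ^ (1 / q) := by
  have : IsProbabilityMeasure ((μ B)⁻¹ • μ.restrict B) :=
    ⟨by simp [ENNReal.inv_mul_cancel hB₀ hB]⟩
  have key := eLpNorm'_le_eLpNorm'_of_exponent_le hp hpq ((μ B)⁻¹ • μ.restrict B)
    hf.aestronglyMeasurable
  have e : ∀ s : ℝ, 0 < s → eLpNorm' f s ((μ B)⁻¹ • μ.restrict B) =
      ((∫⁻ x in B, ENNReal.ofReal (f x ^ s) ∂μ) / μ B) ^ (1 / s) := fun s hs => by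
    rw [eLpNorm'_eq_lintegral_enorm, lintegral_smul_measure, smul_eq_mul, mul_comm,
      ← div_eq_mul_inv]
    simp only [Real.enorm_of_nonneg (hf₀ _), ENNReal.ofReal_rpow_of_nonneg (hf₀ _) hs.le]
  rwa [e p hp, e q (hp.trans_le hpq)] at key

theorem ENNReal.le_two_mul_of_forall_le_geometric {a : ℕ → ℝ≥0∞} {D L : ℝ≥0∞} (d : ℕ)
    (hL : L ≠ ⊤) (haL : ∀ j, a j ≤ L)
    (h : ∀ j, a j ≤ D * (2 ^ d) ^ j + (2 ^ (d + 1))⁻¹ * a (j + 1)) : a 0 ≤ 2 * D := by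
  have hq : ∀ j, ((2 : ℝ≥0∞) ^ (d + 1))⁻¹ ^ j * (2 ^ d) ^ j = 2⁻¹ ^ j := fun j => by
    rw [← mul_pow, pow_succ, ENNReal.mul_inv (by simp) (by simp), mul_right_comm,
      ENNReal.inv_mul_cancel (by simp) (by simp), one_mul]
  have hsum : ∀ j, a 0 ≤ D * ∑ i ∈ Finset.range j, 2⁻¹ ^ i + (2 ^ (d + 1))⁻¹ ^ j * a j := by
    intro j
    induction j with
    | zero => simp
    | succ j ih =>
      calc a 0 ≤ D * ∑ i ∈ Finset.range j, 2⁻¹ ^ i + (2 ^ (d + 1))⁻¹ ^ j * a j := ih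
        _ ≤ D * ∑ i ∈ Finset.range j, 2⁻¹ ^ i +
            (2 ^ (d + 1))⁻¹ ^ j * (D * (2 ^ d) ^ j + (2 ^ (d + 1))⁻¹ * a (j + 1)) := by
          gcongr; exact h j
        _ = _ := by
          rw [Finset.sum_range_succ, mul_add D, ← hq j]
          ring
  have hgeo : ∀ j, ∑ i ∈ Finset.range j, (2⁻¹ : ℝ≥0∞) ^ i ≤ 2 := fun j => by
    refine (ENNReal.sum_le_tsum _).trans ?_
    rw [ENNReal.tsum_geometric, ENNReal.one_sub_inv_two, inv_inv]
  have hbd : ∀ j, a 0 ≤ 2 * D + 2⁻¹ ^ j * L := fun j => by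
    refine (hsum j).trans ?_
    rw [mul_comm 2 D]
    gcongr
    · exact hgeo j
    · rw [pow_succ]
      exact le_mul_of_one_le_left zero_le (one_le_pow_of_one_le' (by norm_num) d)
    · exact haL j
  have hlim : Filter.Tendsto (fun j : ℕ => 2 * D + 2⁻¹ ^ j * L) Filter.atTop
      (nhds (2 * D + 0 * L)) := by
    refine tendsto_const_nhds.add (ENNReal.Tendsto.mul_const ?_ (Or.inr hL))
    exact ENNReal.tendsto_pow_atTop_nhds_zero_of_lt_one (by simp)
  simpa using ge_of_tendsto' hlim hbd

theorem exists_stopping_radius {X : Type*} [PseudoMetricSpace X] [MeasurableSpace X]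
    {μ : Measure X} {F : X → ℝ≥0∞} {x : X} {δ : ℝ} (hδ : 0 < δ) {t : ℝ≥0∞}
    (hlim : Filter.Tendsto (fun ρ => (∫⁻ y in ball x ρ, F y ∂μ) / μ (ball x ρ))
      (nhdsWithin 0 (Ioi 0)) (nhds (F x))) (htx : t < F x)
    (havg : ∀ m : ℕ, m ≤ 2 →
      (∫⁻ y in ball x (δ / 3 ^ m), F y ∂μ) / μ (ball x (δ / 3 ^ m)) ≤ t) :
    ∃ ρ : ℝ, 0 < ρ ∧ 27 * ρ ≤ δ ∧
      t < (∫⁻ y in ball x ρ, F y ∂μ) / μ (ball x ρ) ∧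
      (∫⁻ y in ball x (3 * ρ), F y ∂μ) / μ (ball x (3 * ρ)) ≤ t ∧
      (∫⁻ y in ball x (27 * ρ), F y ∂μ) / μ (ball x (27 * ρ)) ≤ t := by
  classical
  have hseq : Filter.Tendsto (fun m : ℕ => δ / 3 ^ m) Filter.atTop (nhdsWithin 0 (Ioi 0)) := by
    refine tendsto_nhdsWithin_iff.2 ⟨?_, Filter.Eventually.of_forall fun m => ?_⟩
    · simpa [div_eq_mul_inv] using
        (tendsto_pow_atTop_nhds_zero_of_lt_one (r := (3 : ℝ)⁻¹) (by norm_num)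
          (by norm_num)).const_mul δ
    · simp only [mem_Ioi]; positivity
  have hex : ∃ m : ℕ, t < (∫⁻ y in ball x (δ / 3 ^ m), F y ∂μ) / μ (ball x (δ / 3 ^ m)) :=
    ((hlim.comp hseq).eventually (lt_mem_nhds htx)).exists
  obtain ⟨k, hk⟩ : ∃ k, Nat.find hex = k + 3 := by
    have : 2 < Nat.find hex := by
      by_contra! hcon
      exact absurd (Nat.find_spec hex) (not_lt.2 (havg _ hcon))
    exact ⟨Nat.find hex - 3, by omega⟩
  have hmin : ∀ m, m < k + 3 →
      (∫⁻ y in ball x (δ / 3 ^ m), F y ∂μ) / μ (ball x (δ / 3 ^ m)) ≤ t := fun m hm =>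
    not_lt.1 (Nat.find_min hex (hk ▸ hm))
  have hspec := Nat.find_spec hex
  rw [hk] at hspec
  refine ⟨δ / 3 ^ (k + 3), by positivity, ?_, hspec, ?_, ?_⟩
  · rw [mul_div_assoc', div_le_iff₀ (by positivity), pow_add]
    have : (1 : ℝ) ≤ 3 ^ k := one_le_pow₀ (by norm_num)
    nlinarith
  · have : 3 * (δ / 3 ^ (k + 3)) = δ / 3 ^ (k + 2) := by rw [pow_succ _ (k + 2)]; field_simp
    rw [this]
    exact hmin _ (by omega)
  · have : 27 * (δ / 3 ^ (k + 3)) = δ / 3 ^ k := by rw [pow_add]; field_simp; norm_num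
    rw [this]
    exact hmin _ (by omega)

section Euclidean

variable {E : Type*} [NormedAddCommGroup E] [NormedSpace ℝ E] [FiniteDimensional ℝ E]
  [Nontrivial E] [MeasurableSpace E] [BorelSpace E] {μ : Measure E} [μ.IsAddHaarMeasure]

theorem measure_ball_mul_eq (x y : E) {a : ℝ} (ha : 0 ≤ a) (s : ℝ) :
    μ (ball x (a * s)) = ENNReal.ofReal a ^ Module.finrank ℝ E * μ (ball y s) := by
  rw [Measure.addHaar_ball_mul μ x ha s, Measure.addHaar_ball_center μ y s,
    ENNReal.ofReal_pow ha]

theorem ae_tendsto_lintegral_ball_div {F : E → ℝ≥0∞} (hF : Measurable F) {U : Set E}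
    (hU : IsOpen U) (hfin : ∫⁻ x in U, F x ∂μ ≠ ⊤) :
    ∀ᵐ x ∂μ, x ∈ U → Filter.Tendsto (fun ρ => (∫⁻ y in ball x ρ, F y ∂μ) / μ (ball x ρ))
      (nhdsWithin 0 (Ioi 0)) (nhds (F x)) := by
  have : ProperSpace E := FiniteDimensional.proper_real E
  have hind : ∫⁻ x, U.indicator F x ∂μ ≠ ⊤ := by
    rwa [lintegral_indicator hU.measurableSet]
  filter_upwards [(Besicovitch.vitaliFamily μ).ae_tendsto_lintegral_div
    (hF.indicator hU.measurableSet).aemeasurable hind] with x hx hxU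
  have h1 := hx.comp (Besicovitch.tendsto_filterAt μ x)
  rw [indicator_of_mem hxU] at h1
  refine h1.congr' ?_
  obtain ⟨R, hR, hRU⟩ := Metric.isOpen_iff.1 hU x hxU
  filter_upwards [Ioo_mem_nhdsGT hR] with ρ hρ
  have hsub : closedBall x ρ ⊆ U := (closedBall_subset_ball hρ.2).trans hRU
  have hae : closedBall x ρ =ᵐ[μ] ball x ρ := by
    refine (Filter.EventuallyLE.antisymm ?_ ?_)
    · rw [ae_le_set, closedBall_sdiff_ball, Measure.addHaar_sphere]
    · exact ball_subset_closedBall.eventuallyLE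
  simp only [Function.comp]
  rw [Measure.addHaar_closedBall_eq_addHaar_ball, ← Measure.restrict_congr_set hae]
  congr 1
  exact setLIntegral_congr_fun measurableSet_closedBall fun y hy =>
    indicator_of_mem (hsub hy) F

theorem lintegral_superlevel_le_of_reverseHolder {f g : E → ℝ} (hf : Measurable f)
    (hg : Measurable g) (hf₀ : ∀ x, 0 ≤ f x) {x₀ : E} {r δ : ℝ} (hδ : 0 < δ)
    (hfin : ∫⁻ x in ball x₀ (r + δ), ENNReal.ofReal (f x) ∂μ ≠ ⊤)
    {A κ t : ℝ} (hA : 1 ≤ A) (hκ : 1 / 2 ≤ κ) (hκ₁ : κ < 1) (ht : 0 < t)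
    (havg : ∀ x ∈ ball x₀ r, ∀ m : ℕ, m ≤ 2 →
      (∫⁻ y in ball x (δ / 3 ^ m), ENNReal.ofReal (f y) ∂μ) / μ (ball x (δ / 3 ^ m)) ≤
        ENNReal.ofReal t)
    (hRH : ∀ x ∈ ball x₀ r, ∀ ρ : ℝ, 0 < ρ → 3 * ρ ≤ δ →
      (∫⁻ y in ball x (3 * ρ), ENNReal.ofReal (f y) ∂μ) / μ (ball x (3 * ρ)) ≤
        (∫⁻ y in ball x ρ, ENNReal.ofReal (f y) ∂μ) / μ (ball x ρ) →
      (∫⁻ y in ball x ρ, ENNReal.ofReal (f y) ∂μ) / μ (ball x ρ) ≤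
        ENNReal.ofReal A *
            ((∫⁻ y in ball x (3 * ρ), ENNReal.ofReal (f y ^ κ) ∂μ) / μ (ball x (3 * ρ))) ^
              (1 / κ) +
          (∫⁻ y in ball x (3 * ρ), ENNReal.ofReal (g y) ∂μ) / μ (ball x (3 * ρ))) :
    ∫⁻ x in ball x₀ r ∩ {x | t < f x}, ENNReal.ofReal (f x) ∂μ ≤
      9 ^ Module.finrank ℝ E * (ENNReal.ofReal (4 * A * t ^ (1 - κ)) *
          ∫⁻ x in ball x₀ (r + δ) ∩ {x | t / (8 * A) < f x}, ENNReal.ofReal (f x ^ κ) ∂μ +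
        4 * ∫⁻ x in ball x₀ (r + δ) ∩ {x | t / 4 < g x}, ENNReal.ofReal (g x) ∂μ) := by
  have : ProperSpace E := FiniteDimensional.proper_real E
  set d := Module.finrank ℝ E
  let P : Measure E := (μ.withDensity fun x => ENNReal.ofReal (f x ^ κ)).restrict
    {x | t / (8 * A) < f x}
  let Q : Measure E := (μ.withDensity fun x => ENNReal.ofReal (g x)).restrict {x | t / 4 < g x}
  have hPB : ∀ B, MeasurableSet B →
      P B = ∫⁻ x in B ∩ {x | t / (8 * A) < f x}, ENNReal.ofReal (f x ^ κ) ∂μ := fun B hB => by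
    rw [Measure.restrict_apply hB,
      withDensity_apply _ (hB.inter (measurableSet_lt measurable_const hf))]
  have hQB : ∀ B, MeasurableSet B →
      Q B = ∫⁻ x in B ∩ {x | t / 4 < g x}, ENNReal.ofReal (g x) ∂μ := fun B hB => by
    rw [Measure.restrict_apply hB,
      withDensity_apply _ (hB.inter (measurableSet_lt measurable_const hg))]
  let Ψ : Measure E := (9 : ℝ≥0∞) ^ d • (ENNReal.ofReal (4 * A * t ^ (1 - κ)) • P + (4 : ℝ≥0∞) • Q)
  have hΨ : ∀ B, Ψ B = 9 ^ d * (ENNReal.ofReal (4 * A * t ^ (1 - κ)) * P B + 4 * Q B) :=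
    fun B => by simp [Ψ, mul_add]
  rw [← hPB _ measurableSet_ball, ← hQB _ measurableSet_ball, ← hΨ]
  let ν : Measure E := μ.withDensity fun x => ENNReal.ofReal (f x)
  have hνB : ∀ B, MeasurableSet B → ν B = ∫⁻ x in B, ENNReal.ofReal (f x) ∂μ :=
    fun B hB => withDensity_apply _ hB
  rw [← hνB _ (measurableSet_ball.inter (measurableSet_lt measurable_const hf))]
  have hleb := (withDensity_absolutelyContinuous μ fun x => ENNReal.ofReal (f x)).ae_le
    (ae_tendsto_lintegral_ball_div (hf.ennreal_ofReal) isOpen_ball hfin)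
  set L : Set E := {x | x ∈ ball x₀ (r + δ) → Filter.Tendsto
    (fun ρ => (∫⁻ y in ball x ρ, ENNReal.ofReal (f y) ∂μ) / μ (ball x ρ))
      (nhdsWithin 0 (Ioi 0)) (nhds (ENNReal.ofReal (f x)))}
  have hae : ν (ball x₀ r ∩ {x | t < f x}) ≤ ν (ball x₀ r ∩ {x | t < f x} ∩ L) := by
    refine measure_mono_ae ?_
    filter_upwards [hleb] with x hx hx'
    exact ⟨hx', hx⟩
  refine hae.trans (measure_le_of_forall_closedBall_le (δ := δ) ν Ψ ?_)
  rintro x ⟨⟨hxr, hxt⟩, hxL⟩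
  have hxL := hxL (ball_subset_ball (by linarith) hxr)
  obtain ⟨ρ, hρ, hρδ, h1, h3, h27⟩ := exists_stopping_radius hδ hxL
    ((ENNReal.ofReal_lt_ofReal_iff (ht.trans hxt)).2 hxt) (havg x hxr)
  have hpos : ∀ {s : ℝ}, 0 < s → μ (ball x s) ≠ 0 := fun hs => (measure_ball_pos μ x hs).ne'
  have htop : ∀ {s : ℝ}, μ (ball x s) ≠ ⊤ := measure_ball_lt_top.ne
  refine ⟨3 * ρ, by positivity, by linarith, ?_, ?_⟩
  · refine (closedBall_subset_ball (show 3 * ρ < δ by linarith)).trans (ball_subset_ball' ?_)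
    rw [mem_ball] at hxr
    linarith
  · have hmain := ofReal_mul_measure_le_of_reverseHolder (hpos (by positivity : 0 < 3 * ρ)) htop
      hf hg hf₀ hA hκ hκ₁ ht (h1.le.trans (hRH x hxr ρ hρ (by linarith) (h3.trans h1.le)))
    rw [← hPB _ measurableSet_ball, ← hQB _ measurableSet_ball] at hmain
    rw [ENNReal.div_le_iff (hpos (by positivity)) htop, ← hνB _ measurableSet_ball] at h27
    calc ν (closedBall x (5 * (3 * ρ))) ≤ ν (ball x (27 * ρ)) :=
          measure_mono (closedBall_subset_ball (by linarith))
      _ ≤ ENNReal.ofReal t * μ (ball x (27 * ρ)) := h27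
      _ = 9 ^ d * (ENNReal.ofReal t * μ (ball x (3 * ρ))) := by
          rw [show 27 * ρ = 9 * (3 * ρ) by ring, measure_ball_mul_eq x x (by norm_num)]
          simp only [ENNReal.ofReal_ofNat]
          ring
      _ ≤ Ψ (ball x (3 * ρ)) := by
          rw [hΨ]; gcongr
      _ ≤ Ψ (closedBall x (3 * ρ)) := measure_mono ball_subset_closedBall

theorem lintegral_mul_min_rpow_ball_le_of_reverseHolder {f g : E → ℝ} (hf : Measurable f)
    (hg : Measurable g) (hf₀ : ∀ x, 0 ≤ f x) (hg₀ : ∀ x, 0 ≤ g x) {x₀ : E} {R : ℝ} (hR : 0 < R)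
    (hfin : ∫⁻ x in ball x₀ (3 * R), ENNReal.ofReal (f x) ∂μ ≠ ⊤)
    {A κ ε N : ℝ} (hA : 1 ≤ A) (hκ : 1 / 2 ≤ κ) (hκ₁ : κ < 1) (hε : 0 < ε) (hε₁ : ε ≤ 1)
    (hεκ : 2 ^ (Module.finrank ℝ E + 1) * 9 ^ Module.finrank ℝ E * (256 * A ^ 3) * ε ≤ 1 - κ)
    (hN : 0 < N)
    (hRH : ∀ (x : E) (ρ : ℝ), 0 < ρ → ρ ≤ R → ball x (3 * ρ) ⊆ ball x₀ (3 * R) →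
      (∫⁻ y in ball x (3 * ρ), ENNReal.ofReal (f y) ∂μ) / μ (ball x (3 * ρ)) ≤
        (∫⁻ y in ball x ρ, ENNReal.ofReal (f y) ∂μ) / μ (ball x ρ) →
      (∫⁻ y in ball x ρ, ENNReal.ofReal (f y) ∂μ) / μ (ball x ρ) ≤
        ENNReal.ofReal A *
            ((∫⁻ y in ball x (3 * ρ), ENNReal.ofReal (f y ^ κ) ∂μ) / μ (ball x (3 * ρ))) ^
              (1 / κ) +
          (∫⁻ y in ball x (3 * ρ), ENNReal.ofReal (g y) ∂μ) / μ (ball x (3 * ρ))) :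
    ∫⁻ x in ball x₀ R, ENNReal.ofReal (f x * min (f x) N ^ ε) ∂μ ≤
      2 * (27 ^ Module.finrank ℝ E *
          ((∫⁻ x in ball x₀ (3 * R), ENNReal.ofReal (f x) ∂μ) / μ (ball x₀ (3 * R))) ^ ε *
          ∫⁻ x in ball x₀ (3 * R), ENNReal.ofReal (f x) ∂μ +
        9 ^ Module.finrank ℝ E * ENNReal.ofReal (4 * A) *
          (4 * ∫⁻ x in ball x₀ (3 * R), ENNReal.ofReal (g x ^ (1 + ε)) ∂μ)) := by
  set d := Module.finrank ℝ E
  set I := ∫⁻ x in ball x₀ (3 * R), ENNReal.ofReal (f x) ∂μ with hI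
  set V := μ (ball x₀ (3 * R)) with hV
  set G := ∫⁻ x in ball x₀ (3 * R), ENNReal.ofReal (g x ^ (1 + ε)) ∂μ with hG
  have hA₀ : 0 < A := by linarith
  have hV₀ : V ≠ 0 := (measure_ball_pos μ x₀ (by positivity)).ne'
  have hVt : V ≠ ⊤ := measure_ball_lt_top.ne
  have hMt : I / V ≠ ⊤ := ENNReal.div_ne_top hfin hV₀
  obtain ⟨M, hM₀, hM⟩ : ∃ M : ℝ, 0 ≤ M ∧ ENNReal.ofReal M = I / V :=
    ⟨(I / V).toReal, ENNReal.toReal_nonneg, ENNReal.ofReal_toReal hMt⟩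
  rw [← hM]
  set r : ℕ → ℝ := fun j => (3 - 2 * (2⁻¹) ^ j) * R with hr
  have hr0 : r 0 = R := by simp [hr]; norm_num
  have hrsucc : ∀ j, r (j + 1) = r j + R / 2 ^ j := fun j => by
    simp only [hr, pow_succ, inv_pow]; field_simp; ring
  have hrle : ∀ j, r j ≤ 3 * R := fun j => by
    have : (0 : ℝ) ≤ 2⁻¹ ^ j := by positivity
    simp only [hr]; gcongr; linarith
  have hsub : ∀ j, ball x₀ (r j) ⊆ ball x₀ (3 * R) := fun j => ball_subset_ball (hrle j)
  rw [← hr0]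
  refine ENNReal.le_two_mul_of_forall_le_geometric
    (a := fun j => ∫⁻ x in ball x₀ (r j), ENNReal.ofReal (f x * min (f x) N ^ ε) ∂μ)
    (L := ENNReal.ofReal (N ^ ε) * I) d (ENNReal.mul_ne_top ENNReal.ofReal_ne_top hfin) ?_ ?_
  · intro j
    rw [hI, ← lintegral_const_mul _ hf.ennreal_ofReal]
    refine (lintegral_mono_set (hsub j)).trans (lintegral_mono fun x => ?_)
    rw [← ENNReal.ofReal_mul (by positivity), mul_comm]
    apply ENNReal.ofReal_le_ofReal
    have := hf₀ x
    gcongr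
    exact min_le_right _ _
  · intro j
    have hδ : 0 < R / 2 ^ j := by positivity
    have hball : ∀ x ∈ ball x₀ (r j), ∀ s ≤ R / 2 ^ j, ball x s ⊆ ball x₀ (3 * R) := by
      intro x hx s hs
      refine (ball_subset_ball' ?_).trans (hsub (j + 1))
      rw [mem_ball] at hx
      rw [hrsucc]
      linarith
    have h2j : (1 : ℝ) ≤ 2 ^ j := one_le_pow₀ (by norm_num)
    have hδR : R / 2 ^ j ≤ R := div_le_self hR.le h2j
    have hstep := lintegral_mul_min_rpow_le (μ := μ) (B := ball x₀ (r j))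
      (B' := ball x₀ (r (j + 1))) hf hg hf₀ hg₀ (C := 9 ^ d * ENNReal.ofReal (4 * A))
      (K := 8 * A) (κ := κ) (ε := ε) (t₀ := M * (27 * 2 ^ j) ^ d) (N := N)
      (by linarith) (by linarith) hκ₁ hε hε₁ (by positivity) hN ?_
    · have hcoef : 9 ^ d * ENNReal.ofReal (4 * A) *
          ENNReal.ofReal ((8 * A) ^ 2 * (ε / (1 - κ))) ≤ (2 ^ (d + 1))⁻¹ := by
        have h1κ : 0 < 1 - κ := by linarith
        have e9 : (9 : ℝ≥0∞) ^ d = ENNReal.ofReal (9 ^ d) := by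
          rw [ENNReal.ofReal_pow (by norm_num)]; simp
        have e2 : ((2 : ℝ≥0∞) ^ (d + 1))⁻¹ = ENNReal.ofReal (2 ^ (d + 1))⁻¹ := by
          rw [ENNReal.ofReal_inv_of_pos (by positivity), ENNReal.ofReal_pow (by norm_num)]; simp
        rw [e9, e2, ← ENNReal.ofReal_mul (by positivity), ← ENNReal.ofReal_mul (by positivity)]
        apply ENNReal.ofReal_le_ofReal
        rw [← div_le_one h1κ] at hεκ
        rw [← one_div, le_div_iff₀ (by positivity)]
        refine le_trans (le_of_eq ?_) hεκ
        ring
      have ht₀ : ENNReal.ofReal ((M * (27 * 2 ^ j) ^ d) ^ ε) ≤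
          27 ^ d * ENNReal.ofReal M ^ ε * (2 ^ d) ^ j := by
        have e : (27 : ℝ≥0∞) ^ d * ENNReal.ofReal M ^ ε * (2 ^ d) ^ j =
            ENNReal.ofReal (M ^ ε * (27 * 2 ^ j) ^ d) := by
          rw [ENNReal.ofReal_mul (by positivity), ← ENNReal.ofReal_rpow_of_nonneg hM₀ hε.le,
            ENNReal.ofReal_pow (by positivity), ENNReal.ofReal_mul (by norm_num),
            ENNReal.ofReal_pow (by norm_num)]
          simp only [ENNReal.ofReal_ofNat]
          ring
        rw [e, Real.mul_rpow hM₀ (by positivity)]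
        apply ENNReal.ofReal_le_ofReal
        gcongr
        conv_rhs => rw [← Real.rpow_one ((27 * 2 ^ j) ^ d)]
        exact Real.rpow_le_rpow_of_exponent_le (one_le_pow₀ (by linarith)) hε₁
      refine hstep.trans ?_
      rw [mul_add (9 ^ d * ENNReal.ofReal (4 * A)), ← mul_assoc, add_left_comm, add_comm, add_mul]
      have h2d : (1 : ℝ≥0∞) ≤ (2 ^ d) ^ j :=
        one_le_pow_of_one_le' (one_le_pow_of_one_le' (by norm_num) d) j
      gcongr ?_ + ?_ * _
      · refine add_le_add ?_ ?_
        · calc _ ≤ 27 ^ d * ENNReal.ofReal M ^ ε * (2 ^ d) ^ j * I := by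
                gcongr
                exact lintegral_mono_set (hsub j)
            _ = _ := by ring
        · calc _ ≤ 9 ^ d * ENNReal.ofReal (4 * A) * (4 * G) := by
                gcongr
                exact lintegral_mono_set (hsub (j + 1))
            _ ≤ _ := le_mul_of_one_le_right zero_le h2d
    · intro t ht ht₀
      have hlev := lintegral_superlevel_le_of_reverseHolder (μ := μ) hf hg hf₀ (x₀ := x₀)
        (r := r j) hδ (by
          rw [← hrsucc]
          exact ne_top_of_le_ne_top hfin (lintegral_mono_set (hsub (j + 1)))) hA hκ hκ₁ ht ?_ ?_
      · rw [← hrsucc] at hlev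
        refine hlev.trans ?_
        have h4 : (4 : ℝ≥0∞) ≤ ENNReal.ofReal (4 * A) := by
          rw [show (4 : ℝ≥0∞) = ENNReal.ofReal 4 by simp]
          exact ENNReal.ofReal_le_ofReal (by linarith)
        rw [ENNReal.ofReal_mul (by positivity), mul_assoc (9 ^ d), mul_add (ENNReal.ofReal (4 * A)),
          ← mul_assoc (ENNReal.ofReal (4 * A))]
        gcongr
      · intro x hx m hm
        have hs : 0 < R / 2 ^ j / 3 ^ m := by positivity
        have h3m : (1 : ℝ) ≤ 3 ^ m := one_le_pow₀ (by norm_num)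
        rw [ENNReal.div_le_iff (measure_ball_pos μ x hs).ne' measure_ball_lt_top.ne]
        have hVs : V = ENNReal.ofReal (3 * 2 ^ j * 3 ^ m) ^ d * μ (ball x (R / 2 ^ j / 3 ^ m)) := by
          rw [← measure_ball_mul_eq x₀ x (by positivity), hV]
          congr 2
          field_simp
        calc ∫⁻ y in ball x (R / 2 ^ j / 3 ^ m), ENNReal.ofReal (f y) ∂μ
            ≤ I := lintegral_mono_set (hball x hx _ (div_le_self hδ.le h3m))
          _ = ENNReal.ofReal M * V := by rw [hM, ENNReal.div_mul_cancel hV₀ hVt]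
          _ = ENNReal.ofReal (M * (3 * 2 ^ j * 3 ^ m) ^ d) * μ (ball x (R / 2 ^ j / 3 ^ m)) := by
            rw [ENNReal.ofReal_mul hM₀, ENNReal.ofReal_pow (by positivity), hVs]
            ring
          _ ≤ _ := by
            gcongr
            refine le_trans ?_ ht₀
            have : (3 : ℝ) ^ m ≤ 3 ^ 2 := pow_le_pow_right₀ (by norm_num) hm
            gcongr M * ?_ ^ d
            nlinarith
      · intro x hx ρ hρ hρδ
        exact hRH x ρ hρ (by linarith) (hball x hx _ hρδ)

theorem rpow_laverage_ball_le_of_reverseHolder {f g : E → ℝ} (hf : Measurable f)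
    (hg : Measurable g) (hf₀ : ∀ x, 0 ≤ f x) (hg₀ : ∀ x, 0 ≤ g x) {x₀ : E} {R : ℝ} (hR : 0 < R)
    (hfin : ∫⁻ x in ball x₀ (3 * R), ENNReal.ofReal (f x) ∂μ ≠ ⊤)
    {A κ ε : ℝ} (hA : 1 ≤ A) (hκ : 1 / 2 ≤ κ) (hκ₁ : κ < 1) (hε : 0 < ε) (hε₁ : ε ≤ 1)
    (hεκ : 2 ^ (Module.finrank ℝ E + 1) * 9 ^ Module.finrank ℝ E * (256 * A ^ 3) * ε ≤ 1 - κ)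
    (hRH : ∀ (x : E) (ρ : ℝ), 0 < ρ → ρ ≤ R → ball x (3 * ρ) ⊆ ball x₀ (3 * R) →
      (∫⁻ y in ball x (3 * ρ), ENNReal.ofReal (f y) ∂μ) / μ (ball x (3 * ρ)) ≤
        (∫⁻ y in ball x ρ, ENNReal.ofReal (f y) ∂μ) / μ (ball x ρ) →
      (∫⁻ y in ball x ρ, ENNReal.ofReal (f y) ∂μ) / μ (ball x ρ) ≤
        ENNReal.ofReal A *
            ((∫⁻ y in ball x (3 * ρ), ENNReal.ofReal (f y ^ κ) ∂μ) / μ (ball x (3 * ρ))) ^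
              (1 / κ) +
          (∫⁻ y in ball x (3 * ρ), ENNReal.ofReal (g y) ∂μ) / μ (ball x (3 * ρ))) :
    ((∫⁻ x in ball x₀ R, ENNReal.ofReal (f x ^ (1 + ε)) ∂μ) / μ (ball x₀ R)) ^ (1 / (1 + ε)) ≤
      ENNReal.ofReal (2 * 81 ^ Module.finrank ℝ E * (16 * A)) *
          ((∫⁻ x in ball x₀ (3 * R), ENNReal.ofReal (f x) ∂μ) / μ (ball x₀ (3 * R))) +
        ENNReal.ofReal (2 * 81 ^ Module.finrank ℝ E * (16 * A)) *
          ((∫⁻ x in ball x₀ (3 * R), ENNReal.ofReal (g x ^ (1 + ε)) ∂μ) /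
            μ (ball x₀ (3 * R))) ^ (1 / (1 + ε)) := by
  have hmono : ∫⁻ x in ball x₀ R, ENNReal.ofReal (f x ^ (1 + ε)) ∂μ ≤
      ⨆ N : ℕ, ∫⁻ x in ball x₀ R, ENNReal.ofReal (f x * min (f x) (N + 1) ^ ε) ∂μ := by
    rw [← lintegral_iSup (fun N => by fun_prop)]
    · refine lintegral_mono fun x => ?_
      obtain ⟨N, hN⟩ := exists_nat_ge (f x)
      refine le_iSup_of_le N (le_of_eq ?_)
      rw [min_eq_left (by linarith), Real.rpow_add_of_nonneg (hf₀ x) zero_le_one hε.le,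
        Real.rpow_one]
    · intro N N' hNN x
      apply ENNReal.ofReal_le_ofReal
      have := hf₀ x
      gcongr
  have hbd := hmono.trans (iSup_le fun N : ℕ =>
    lintegral_mul_min_rpow_ball_le_of_reverseHolder (N := (N : ℝ) + 1) hf hg hf₀ hg₀ hR hfin
      hA hκ hκ₁ hε hε₁ hεκ (by positivity) hRH)
  set d := Module.finrank ℝ E
  set I := ∫⁻ x in ball x₀ (3 * R), ENNReal.ofReal (f x) ∂μ
  set V := μ (ball x₀ (3 * R)) with hV
  set G := ∫⁻ x in ball x₀ (3 * R), ENNReal.ofReal (g x ^ (1 + ε)) ∂μ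
  set W := μ (ball x₀ R)
  have hV₀ : V ≠ 0 := (measure_ball_pos μ x₀ (by positivity)).ne'
  have hVt : V ≠ ⊤ := measure_ball_lt_top.ne
  have hW₀ : W ≠ 0 := (measure_ball_pos μ x₀ (by positivity)).ne'
  have hWt : W ≠ ⊤ := measure_ball_lt_top.ne
  have hVW : V = 3 ^ d * W := by
    rw [hV, measure_ball_mul_eq x₀ x₀ (by norm_num)]; simp [d, W]
  have hp : 0 < 1 + ε := by linarith
  set T := (G / V) ^ (1 / (1 + ε)) with hT
  have hTp : T ^ (1 + ε) = G / V := by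
    rw [hT, one_div, ENNReal.rpow_inv_rpow hp.ne']
  have hMp : (I / V) ^ ε * (I / V) = (I / V) ^ (1 + ε) := by
    rw [ENNReal.rpow_add_of_nonneg _ _ zero_le_one hε.le, ENNReal.rpow_one, mul_comm]
  set c : ℝ≥0∞ := ENNReal.ofReal (2 * 81 ^ d * (16 * A)) with hc
  have hcA : c = 2 * 81 ^ d * (4 * ENNReal.ofReal (4 * A)) := by
    rw [hc, show 2 * 81 ^ d * (16 * A) = 2 * 81 ^ d * (4 * (4 * A)) by ring,
      ENNReal.ofReal_mul (by positivity), ENNReal.ofReal_mul (by positivity),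
      ENNReal.ofReal_pow (by norm_num), ENNReal.ofReal_mul (p := 4) (by norm_num)]
    simp
  have hA4 : (1 : ℝ≥0∞) ≤ ENNReal.ofReal (4 * A) := by
    rw [ENNReal.one_le_ofReal]; linarith
  have hc1 : 1 ≤ c := by
    rw [hc, ENNReal.one_le_ofReal]
    have : (1 : ℝ) ≤ 81 ^ d := one_le_pow₀ (by norm_num)
    nlinarith
  have hmain : (∫⁻ x in ball x₀ R, ENNReal.ofReal (f x ^ (1 + ε)) ∂μ) / W ≤
      c * ((I / V) ^ (1 + ε) + T ^ (1 + ε)) := by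
    rw [ENNReal.div_le_iff hW₀ hWt]
    refine hbd.trans ?_
    have hI : I = I / V * (3 ^ d * W) := by rw [← hVW, ENNReal.div_mul_cancel hV₀ hVt]
    have hG : G = G / V * (3 ^ d * W) := by rw [← hVW, ENNReal.div_mul_cancel hV₀ hVt]
    calc 2 * (27 ^ d * (I / V) ^ ε * I + 9 ^ d * ENNReal.ofReal (4 * A) * (4 * G))
        = 2 * (27 ^ d * (I / V) ^ ε * (I / V * (3 ^ d * W)) +
            9 ^ d * ENNReal.ofReal (4 * A) * (4 * (G / V * (3 ^ d * W)))) := by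
          rw [← hI, ← hG]
      _ = 2 * ((27 * 3) ^ d * 1 * ((I / V) ^ ε * (I / V)) +
            (9 * 3) ^ d * (4 * ENNReal.ofReal (4 * A)) * (G / V)) * W := by
          rw [mul_pow, mul_pow]; ring
      _ ≤ 2 * (81 ^ d * (4 * ENNReal.ofReal (4 * A)) * ((I / V) ^ ε * (I / V)) +
            81 ^ d * (4 * ENNReal.ofReal (4 * A)) * (G / V)) * W := by
          gcongr
          · norm_num
          · exact one_le_mul (by norm_num) hA4
          · norm_num
      _ = c * ((I / V) ^ (1 + ε) + T ^ (1 + ε)) * W := by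
          rw [hMp, hTp, hcA]; ring
  calc _ ≤ (c * ((I / V) ^ (1 + ε) + T ^ (1 + ε))) ^ (1 / (1 + ε)) :=
        ENNReal.rpow_le_rpow hmain (by positivity)
    _ = c ^ (1 / (1 + ε)) * ((I / V) ^ (1 + ε) + T ^ (1 + ε)) ^ (1 / (1 + ε)) :=
        ENNReal.mul_rpow_of_nonneg _ _ (by positivity)
    _ ≤ c * (I / V + T) := by
        gcongr
        · conv_rhs => rw [← ENNReal.rpow_one c]
          exact ENNReal.rpow_le_rpow_of_exponent_le hc1
            ((div_le_one hp).2 (by linarith))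
        · exact ENNReal.rpow_add_rpow_le_add _ _ (by linarith)
    _ = c * (I / V) + c * T := mul_add _ _ _

end Euclidean

theorem lintegral_lt_top_of_forall_ball {X : Type*} [PseudoMetricSpace X] [MeasurableSpace X]
    {μ : Measure X} {F : X → ℝ≥0∞} {K Ω : Set X} (hΩ : IsOpen Ω)
    (hKΩ : K ⊆ Ω) (hK : IsCompact K) {R₀ : ℝ} (hR₀ : 0 < R₀)
    (h : ∀ (x : X) (R : ℝ), 0 < R → R ≤ R₀ → closure (ball x (3 * R)) ⊆ Ω →
      ∫⁻ y in ball x R, F y ∂μ < ⊤) :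
    ∫⁻ x in K, F x ∂μ < ⊤ := by
  refine hK.induction_on (p := fun s => ∫⁻ x in s, F x ∂μ < ⊤) (by simp)
    (fun s t hst ht => (lintegral_mono_set hst).trans_lt ht)
    (fun s t hs ht => (lintegral_union_le _ _ _).trans_lt (ENNReal.add_lt_top.2 ⟨hs, ht⟩))
    fun x hx => ?_
  obtain ⟨s, hs, hsΩ⟩ := Metric.isOpen_iff.1 hΩ x (hKΩ hx)
  have hR : 0 < min (s / 6) R₀ := by positivity
  refine ⟨ball x (min (s / 6) R₀), mem_nhdsWithin_of_mem_nhds (ball_mem_nhds x hR),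
    h x _ hR (min_le_right _ _) ?_⟩
  refine closure_ball_subset_closedBall.trans ((closedBall_subset_ball ?_).trans hsΩ)
  have := min_le_left (s / 6) R₀
  linarith

/-- **Lemma A.2** (a form of Gehring's lemma): from a reverse Hölder inequality, assumed
only on balls `B_{3R} ⊂⊂ Ω` with `R ≤ R₀` satisfying `⨍_{B_{3R}} f ≤ ⨍_{B_R} f`, one
obtains local higher integrability with gain `ε ≤ min{(1-κ)/c*, ε₀}` and an explicit
reverse Hölder estimate at the higher exponent; the constant `c* = c*(n,A,ε₀)` can be
chosen monotone increasing in `ε₀`. -/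
theorem gehring_lemma_modified (n : ℕ) (hn : 2 ≤ n) (A : ℝ) (hA : 0 < A) :
    ∃ cstar : ℝ → ℝ,
      (∀ ε₀ : ℝ, 0 < ε₀ → 0 < cstar ε₀) ∧ MonotoneOn cstar (Ioi (0 : ℝ)) ∧
      ∀ ε₀ : ℝ, 0 < ε₀ → ∃ c : ℝ, 0 < c ∧
        ∀ (Ω : Set (EuclideanSpace ℝ (Fin n))), IsOpen Ω →
        ∀ f g : EuclideanSpace ℝ (Fin n) → ℝ,
          Measurable f → Measurable g →
          (∀ x, 0 ≤ f x) → (∀ x, 0 ≤ g x) →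
          (∀ K : Set (EuclideanSpace ℝ (Fin n)), K ⊆ Ω → IsCompact K →
            ∫⁻ x in K, ENNReal.ofReal (f x) < ⊤) →
          (∀ K : Set (EuclideanSpace ℝ (Fin n)), K ⊆ Ω → IsCompact K →
            ∫⁻ x in K, ENNReal.ofReal (g x ^ (1 + ε₀)) < ⊤) →
        ∀ κ R₀ : ℝ, 0 < κ → κ < 1 → 0 < R₀ →
          (∀ (x₀ : EuclideanSpace ℝ (Fin n)) (R : ℝ), 0 < R → R ≤ R₀ →
            closure (ball x₀ (3 * R)) ⊆ Ω →
            (∫⁻ x in ball x₀ (3 * R), ENNReal.ofReal (f x)) / volume (ball x₀ (3 * R))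
              ≤ (∫⁻ x in ball x₀ R, ENNReal.ofReal (f x)) / volume (ball x₀ R) →
            (∫⁻ x in ball x₀ R, ENNReal.ofReal (f x)) / volume (ball x₀ R)
              ≤ ENNReal.ofReal A *
                  ((∫⁻ x in ball x₀ (3 * R), ENNReal.ofReal (f x ^ κ)) /
                    volume (ball x₀ (3 * R))) ^ (1 / κ)
                + (∫⁻ x in ball x₀ (3 * R), ENNReal.ofReal (g x)) /
                    volume (ball x₀ (3 * R))) →
        ∀ ε : ℝ, 0 < ε → ε ≤ min ((1 - κ) / cstar ε₀) ε₀ →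
          (∀ K : Set (EuclideanSpace ℝ (Fin n)), K ⊆ Ω → IsCompact K →
            ∫⁻ x in K, ENNReal.ofReal (f x ^ (1 + ε)) < ⊤) ∧
          (∀ (x₀ : EuclideanSpace ℝ (Fin n)) (R : ℝ), 0 < R → R ≤ R₀ →
            closure (ball x₀ (3 * R)) ⊆ Ω →
            ((∫⁻ x in ball x₀ R, ENNReal.ofReal (f x ^ (1 + ε))) /
                volume (ball x₀ R)) ^ (1 / (1 + ε))
              ≤ ENNReal.ofReal c *
                  ((∫⁻ x in ball x₀ (3 * R), ENNReal.ofReal (f x)) /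
                    volume (ball x₀ (3 * R)))
                + ENNReal.ofReal c *
                  ((∫⁻ x in ball x₀ (3 * R), ENNReal.ofReal (g x ^ (1 + ε))) /
                    volume (ball x₀ (3 * R))) ^ (1 / (1 + ε))) := by
  have hn₀ : 0 < n := by omega
  have : Nonempty (Fin n) := ⟨⟨0, hn₀⟩⟩
  have hd : Module.finrank ℝ (EuclideanSpace ℝ (Fin n)) = n := finrank_euclideanSpace_fin
  have : Nontrivial (EuclideanSpace ℝ (Fin n)) :=
    Module.nontrivial_of_finrank_pos (R := ℝ) (by omega)
  set A' : ℝ := max A 1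
  have hA' : 1 ≤ A' := le_max_right _ _
  set C : ℝ := 2 ^ (n + 2) * 9 ^ n * (256 * A' ^ 3) with hC
  have hC1 : 1 ≤ C := by
    have h2 : (1 : ℝ) ≤ 2 ^ (n + 2) := one_le_pow₀ (by norm_num)
    have h9 : (1 : ℝ) ≤ 9 ^ n := one_le_pow₀ (by norm_num)
    have hA3 : (1 : ℝ) ≤ 256 * A' ^ 3 := by
      have := one_le_pow₀ hA' (n := 3)
      linarith
    exact one_le_mul_of_one_le_of_one_le (one_le_mul_of_one_le_of_one_le h2 h9) hA3
  refine ⟨fun _ => C, fun _ _ => by linarith, monotoneOn_const, fun ε₀ hε₀ =>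
    ⟨2 * 81 ^ n * (16 * A'), by positivity, ?_⟩⟩
  intro Ω hΩ f g hf hg hf₀ hg₀ hfΩ hgΩ κ R₀ hκ hκ₁ hR₀ hRH ε hε hεle
  have hεC : C * ε ≤ 1 - κ := by
    have := hεle.trans (min_le_left _ _)
    rwa [le_div_iff₀ (by linarith), mul_comm] at this
  have hεε₀ : ε ≤ ε₀ := hεle.trans (min_le_right _ _)
  have hest : ∀ (x₀ : EuclideanSpace ℝ (Fin n)) (R : ℝ), 0 < R → R ≤ R₀ →
      closure (ball x₀ (3 * R)) ⊆ Ω →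
      ∫⁻ x in ball x₀ (3 * R), ENNReal.ofReal (f x) < ⊤ ∧
      ((∫⁻ x in ball x₀ R, ENNReal.ofReal (f x ^ (1 + ε))) / volume (ball x₀ R)) ^ (1 / (1 + ε))
        ≤ ENNReal.ofReal (2 * 81 ^ n * (16 * A')) *
            ((∫⁻ x in ball x₀ (3 * R), ENNReal.ofReal (f x)) / volume (ball x₀ (3 * R)))
          + ENNReal.ofReal (2 * 81 ^ n * (16 * A')) *
            ((∫⁻ x in ball x₀ (3 * R), ENNReal.ofReal (g x ^ (1 + ε))) /
              volume (ball x₀ (3 * R))) ^ (1 / (1 + ε)) := by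
    intro x₀ R hR hRR₀ hsub
    have hfin : ∫⁻ x in ball x₀ (3 * R), ENNReal.ofReal (f x) < ⊤ :=
      (lintegral_mono_set subset_closure).trans_lt (hfΩ _ hsub isBounded_ball.isCompact_closure)
    refine ⟨hfin, ?_⟩
    have hmain := rpow_laverage_ball_le_of_reverseHolder (μ := volume) hf hg hf₀ hg₀ hR hfin.ne hA'
      (κ := max κ (1 / 2)) (ε := ε) (le_max_right _ _) (max_lt hκ₁ (by norm_num)) hε
      (by nlinarith) ?_ ?_
    · rwa [hd] at hmain
    · rw [hd]
      have e : C * ε = 2 * (2 ^ (n + 1) * 9 ^ n * (256 * A' ^ 3) * ε) := by rw [hC]; ring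
      rcases max_cases κ (1 / 2) with ⟨h1, h2⟩ | ⟨h1, h2⟩ <;> rw [h1]
      · have : 0 ≤ C * ε := by positivity
        linarith
      · linarith
    · intro x ρ hρ hρR hρsub hav
      have hρpos : volume (ball x (3 * ρ)) ≠ 0 :=
        (measure_ball_pos volume x (by positivity)).ne'
      refine (hRH x ρ hρ (hρR.trans hRR₀) ((closure_mono hρsub).trans hsub) hav).trans ?_
      gcongr ?_ + _
      refine mul_le_mul' (ENNReal.ofReal_le_ofReal (le_max_left _ _)) ?_
      exact rpow_laverage_le_of_exponent_le hρpos measure_ball_lt_top.ne hf hf₀ hκ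
        (le_max_left _ _)
  refine ⟨fun K hKΩ hK => lintegral_lt_top_of_forall_ball hΩ hKΩ hK hR₀ fun x R hR hRR₀ hsub => ?_,
    fun x₀ R hR hRR₀ hsub => (hest x₀ R hR hRR₀ hsub).2⟩
  obtain ⟨hfin, hle⟩ := hest x R hR hRR₀ hsub
  have hV₀ : volume (ball x (3 * R)) ≠ 0 := (measure_ball_pos volume x (by positivity)).ne'
  have hp : 0 < 1 / (1 + ε) := by positivity
  have hgfin : ∫⁻ y in ball x (3 * R), ENNReal.ofReal (g y ^ (1 + ε)) < ⊤ := by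
    have hg1 : ∀ y, ENNReal.ofReal (g y ^ (1 + ε)) ≤ 1 + ENNReal.ofReal (g y ^ (1 + ε₀)) := by
      intro y
      have hy := hg₀ y
      rw [← ENNReal.ofReal_one, ← ENNReal.ofReal_add zero_le_one (by positivity)]
      apply ENNReal.ofReal_le_ofReal
      rcases le_total (g y) 1 with h1 | h1
      · have h2 := Real.rpow_le_one hy h1 (by linarith : 0 ≤ 1 + ε)
        have h3 : 0 ≤ g y ^ (1 + ε₀) := by positivity
        linarith
      · have h2 := Real.rpow_le_rpow_of_exponent_le h1 (by linarith : 1 + ε ≤ 1 + ε₀)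
        linarith
    refine (lintegral_mono hg1).trans_lt ?_
    rw [lintegral_add_left measurable_const, ENNReal.add_lt_top]
    refine ⟨by simp [measure_ball_lt_top], ?_⟩
    exact (lintegral_mono_set subset_closure).trans_lt
      (hgΩ _ hsub isBounded_ball.isCompact_closure)
  have hrhs := hle.trans_lt (ENNReal.add_lt_top.2
    ⟨ENNReal.mul_lt_top ENNReal.ofReal_lt_top (ENNReal.div_lt_top hfin.ne hV₀),
      ENNReal.mul_lt_top ENNReal.ofReal_lt_top
        (ENNReal.rpow_lt_top_of_nonneg hp.le (ENNReal.div_lt_top hgfin.ne hV₀).ne)⟩)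
  rw [ENNReal.rpow_lt_top_iff_of_pos hp] at hrhs
  by_contra hcon
  rw [not_lt, top_le_iff] at hcon
  rw [hcon, ENNReal.top_div_of_ne_top measure_ball_lt_top.ne] at hrhs
  exact lt_irrefl _ hrhs
end
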